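/- arXiv:1510.01163 — 8 statements merged into one kernel-verified Lean document; each statement's English description precedes it below -/
import Mathlib

section
/- Let f be a quadratic polynomial in n variables. For every integer r ≥ 1, the minimum of f over the rational grid Δ(n,r) satisfies f_{min,Δ(n,r)} − f_{min,Δ_n} ≤ (1/r)·(f_{max,Δ_n} − f_{min,Δ_n}). -/
open MvPolynomial

/-- A finitely supported exponent vector of degree at most two is `0`, a unit vector, or a sum
of two unit vectors. -/
lemma Finsupp.eq_single_add_single_of_degree_le_two {σ : Type*} (s : σ →₀ ℕ)
    (hs : (s.sum fun _ e => e) ≤ 2) :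
    s = 0 ∨ (∃ a, s = Finsupp.single a 1) ∨
      ∃ a b, s = Finsupp.single a 1 + Finsupp.single b 1 := by
  classical
  have hcard : Multiset.card (Finsupp.toMultiset s) ≤ 2 := by
    rwa [Finsupp.card_toMultiset]
  obtain h | h | h : Multiset.card (Finsupp.toMultiset s) = 0 ∨
      Multiset.card (Finsupp.toMultiset s) = 1 ∨
      Multiset.card (Finsupp.toMultiset s) = 2 := by omega
  · left
    rw [Finsupp.toMultiset_eq_iff.1 (Multiset.card_eq_zero.1 h), map_zero]
  · obtain ⟨a, ha⟩ := Multiset.card_eq_one.1 h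
    refine Or.inr (Or.inl ⟨a, ?_⟩)
    rw [Finsupp.toMultiset_eq_iff.1 ha, Multiset.toFinsupp_singleton]
  · obtain ⟨a, b, hab⟩ := Multiset.card_eq_two.1 h
    refine Or.inr (Or.inr ⟨a, b, ?_⟩)
    rw [Finsupp.toMultiset_eq_iff.1 hab, Multiset.insert_eq_cons, ← Multiset.singleton_add,
      map_add, Multiset.toFinsupp_singleton, Multiset.toFinsupp_singleton]

/-- Averaging a quadratic polynomial over the moves `w ↦ w + h e_i` with weights `x i` agrees with
evaluating it at `w + h x`, up to `h ^ 2` times a constant independent of `w`. -/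
lemma MvPolynomial.sum_mul_eval_add_single {ι : Type*} [Fintype ι] [DecidableEq ι]
    (f : MvPolynomial ι ℝ) (hf : f.totalDegree ≤ 2) (x w : ι → ℝ) (hx : ∑ i, x i = 1) (h : ℝ) :
    ∑ i, x i * eval (w + h • Pi.single i 1) f - eval (w + h • x) f
      = h ^ 2 * (∑ i, x i * eval (Pi.single i 1) f - eval x f) := by
  simp only [eval_eq', Finset.mul_sum]
  rw [Finset.sum_comm, Finset.sum_comm (s := Finset.univ), ← Finset.sum_sub_distrib,
    ← Finset.sum_sub_distrib, Finset.mul_sum]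
  refine Finset.sum_congr rfl fun s hs => ?_
  have hs2 := (le_totalDegree hs).trans hf
  have key (y : ι → ℝ) : ∏ i, y i ^ s i = eval y (monomial s (1 : ℝ)) := by
    simp [eval_monomial, Finsupp.prod_fintype]
  have eval_monomial_single (a : ι) (y : ι → ℝ) :
      eval y (monomial (Finsupp.single a 1) (1 : ℝ)) = y a := by
    simp [eval_monomial]
  have eval_monomial_add (a b : ι) (y : ι → ℝ) :
      eval y (monomial (Finsupp.single a 1 + Finsupp.single b 1) (1 : ℝ)) = y a * y b := by
    rw [← one_mul (1 : ℝ), ← monomial_mul, map_mul, eval_monomial_single, eval_monomial_single]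
  have hδ (a : ι) : ∑ i, x i * (Pi.single i 1 : ι → ℝ) a = x a := by
    simp [Pi.single_apply]
  simp only [key]
  obtain rfl | ⟨a, rfl⟩ | ⟨a, b, rfl⟩ := s.eq_single_add_single_of_degree_le_two hs2
  · simp [← Finset.sum_mul, hx]
  · simp only [eval_monomial_single, Pi.add_apply, Pi.smul_apply, smul_eq_mul]
    generalize coeff _ f = c
    have e1 : ∑ i, x i * (c * (w a + h * (Pi.single i 1 : ι → ℝ) a))
        = c * (w a * ∑ i, x i + h * ∑ i, x i * (Pi.single i 1 : ι → ℝ) a) := by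
      simp only [Finset.mul_sum, ← Finset.sum_add_distrib]
      exact Finset.sum_congr rfl fun i _ => by ring
    have e2 : ∑ i, x i * (c * (Pi.single i 1 : ι → ℝ) a)
        = c * ∑ i, x i * (Pi.single i 1 : ι → ℝ) a := by
      rw [Finset.mul_sum]
      exact Finset.sum_congr rfl fun i _ => by ring
    rw [e1, e2, hδ, hx]
    ring
  · simp only [eval_monomial_add, Pi.add_apply, Pi.smul_apply, smul_eq_mul]
    generalize coeff _ f = c
    have e1 : ∑ i, x i * (c * ((w a + h * (Pi.single i 1 : ι → ℝ) a)
          * (w b + h * (Pi.single i 1 : ι → ℝ) b)))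
        = c * (w a * w b * ∑ i, x i + h * w b * ∑ i, x i * (Pi.single i 1 : ι → ℝ) a
          + h * w a * ∑ i, x i * (Pi.single i 1 : ι → ℝ) b
          + h ^ 2 * ∑ i, x i * ((Pi.single i 1 : ι → ℝ) a * (Pi.single i 1 : ι → ℝ) b)) := by
      simp only [Finset.mul_sum, ← Finset.sum_add_distrib]
      exact Finset.sum_congr rfl fun i _ => by ring
    have e2 : ∑ i, x i * (c * ((Pi.single i 1 : ι → ℝ) a * (Pi.single i 1 : ι → ℝ) b))
        = c * ∑ i, x i * ((Pi.single i 1 : ι → ℝ) a * (Pi.single i 1 : ι → ℝ) b) := by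
      rw [Finset.mul_sum]
      exact Finset.sum_congr rfl fun i _ => by ring
    rw [e1, e2, hδ, hδ, hx]
    ring

/-- If a convex combination is at most `C`, then so is one of the combined values. -/
lemma exists_le_of_sum_mul_le_of_mem_stdSimplex {ι : Type*} [Fintype ι] {x : ι → ℝ}
    (hx : x ∈ stdSimplex ℝ ι) {g : ι → ℝ} {C : ℝ} (h : ∑ i, x i * g i ≤ C) :
    ∃ i, g i ≤ C := by
  by_contra! hg
  obtain ⟨j, -, hj⟩ : ∃ j ∈ Finset.univ, 0 < x j :=
    Finset.exists_lt_of_sum_lt (by simp [hx.2])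
  have hlt : ∑ i, x i * C < ∑ i, x i * g i :=
    Finset.sum_lt_sum (fun i _ => mul_le_mul_of_nonneg_left (hg i).le (hx.1 i))
      ⟨j, Finset.mem_univ j, mul_lt_mul_of_pos_left (hg j) hj⟩
  rw [← Finset.sum_mul, hx.2, one_mul] at hlt
  exact absurd h hlt.not_ge

/-- Moving from `x` towards the grid one vertex at a time, a suitable choice of vertices raises
the value of a quadratic polynomial per step by at most `h ^ 2` times a fixed constant. -/
lemma MvPolynomial.exists_nat_eval_le {ι : Type*} [Fintype ι] [DecidableEq ι]
    (f : MvPolynomial ι ℝ) (hf : f.totalDegree ≤ 2) {x : ι → ℝ} (hx : x ∈ stdSimplex ℝ ι)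
    (h : ℝ) (m : ℕ) :
    ∃ k : ι → ℕ, ∑ i, k i = m ∧
      eval (fun i => h * k i + (1 - h * m) * x i) f
        ≤ eval x f + m * h ^ 2 * (∑ i, x i * eval (Pi.single i 1) f - eval x f) := by
  induction m with
  | zero => exact ⟨0, by simp, by simp⟩
  | succ m ih =>
    obtain ⟨k, hk, hle⟩ := ih
    let w : ι → ℝ := fun i => h * k i + (1 - h * (m + 1)) * x i
    have hw : w + h • x = fun i => h * k i + (1 - h * m) * x i := by
      ext i
      simp [w]
      ring
    have hid := f.sum_mul_eval_add_single hf x w hx.2 h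
    rw [hw] at hid
    obtain ⟨i, hi⟩ := exists_le_of_sum_mul_le_of_mem_stdSimplex hx
      (g := fun i => eval (w + h • Pi.single i 1) f)
      (C := eval x f + (m + 1 : ℕ) * h ^ 2 * (∑ i, x i * eval (Pi.single i 1) f - eval x f))
      (by push_cast; linarith)
    refine ⟨k + Pi.single i 1, by simp [Finset.sum_add_distrib, hk], ?_⟩
    convert hi using 3
    ext j
    by_cases hj : j = i
    · subst hj
      simp [w]
      ring
    · simp [w, hj]

/-- The regular grid `Δ(n,r)` of rational points in the standard simplex with denominator `r`. -/
theorem grid_search_quadratic (n : ℕ) (f : MvPolynomial (Fin n) ℝ)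
    (hf : f.totalDegree ≤ 2) (r : ℕ) (hr : 1 ≤ r) (fmin fmax fgrid : ℝ)
    (hmin : IsLeast ((fun x => eval x f) '' stdSimplex ℝ (Fin n)) fmin)
    (hmax : IsGreatest ((fun x => eval x f) '' stdSimplex ℝ (Fin n)) fmax)
    (hgrid : IsLeast ((fun x => eval x f) ''
      {x | x ∈ stdSimplex ℝ (Fin n) ∧ ∀ i, ∃ k : ℕ, (r : ℝ) * x i = k}) fgrid) :
    fgrid - fmin ≤ (1 / r) * (fmax - fmin) := by
  obtain ⟨⟨x, hx, rfl⟩, -⟩ := hmin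
  have hr0 : (r : ℝ) ≠ 0 := by positivity
  obtain ⟨k, hk, hle⟩ := f.exists_nat_eval_le hf hx (1 / r) r
  have hy : (fun i => 1 / (r : ℝ) * k i + (1 - 1 / r * r) * x i) = fun i => 1 / (r : ℝ) * k i := by
    simp [hr0]
  rw [hy] at hle
  have hfg : fgrid ≤ eval (fun i => 1 / (r : ℝ) * k i) f := by
    refine hgrid.2 ⟨_, ⟨⟨fun i => by positivity, ?_⟩, fun i => ⟨k i, by field_simp⟩⟩, rfl⟩
    rw [← Finset.mul_sum, ← Nat.cast_sum, hk]
    field_simp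
  have hD : ∑ i, x i * eval (Pi.single i 1) f ≤ fmax := by
    calc ∑ i, x i * eval (Pi.single i 1) f ≤ ∑ i, x i * fmax :=
          Finset.sum_le_sum fun i _ => mul_le_mul_of_nonneg_left
            (hmax.2 ⟨_, single_mem_stdSimplex ℝ i, rfl⟩) (hx.1 i)
      _ = fmax := by rw [← Finset.sum_mul, hx.2, one_mul]
  have hrr : (r : ℝ) * (1 / r) ^ 2 = 1 / r := by field_simp
  rw [hrr] at hle
  have : 1 / (r : ℝ) * (∑ i, x i * eval (Pi.single i 1) f - eval x f)
      ≤ 1 / r * (fmax - eval x f) := by gcongr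
  simp only
  linarith
end

section
/- Let f be a polynomial of degree d in n variables. For every integer r ≥ 1, one has f_{min,Δ(n,r)} − f_{min,Δ_n} ≤ (1 − r(r−1)⋯(r−d+1)/r^d) · C(2d−1, d) · d^d · (f_{max,Δ_n} − f_{min,Δ_n}), where r(r−1)⋯(r−d+1) denotes the falling factorial and C(2d−1,d) is the binomial coefficient. -/
open MvPolynomial

open Finset in
theorem sum_neg_one_pow_card_compl_of_range_subset {ι : Type*} [Fintype ι] [DecidableEq ι]
    (g : ι → ι) :
    ∑ s : Finset ι, (if ∀ i, g i ∈ s then (-1 : ℝ) ^ #sᶜ else 0) =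
      if g.Surjective then 1 else 0 := by
  have h := Fintype.prod_add (fun _ : ι => (1 : ℝ)) (fun a => if a ∈ Set.range g then 0 else -1)
  have hl : ∏ a, ((1 : ℝ) + if a ∈ Set.range g then 0 else -1) =
      if g.Surjective then 1 else 0 := by
    split_ifs with hg
    · exact prod_eq_one fun a _ => by simp [hg a]
    · obtain ⟨a, ha⟩ := not_forall.1 hg
      exact prod_eq_zero (mem_univ a) (by simp [ha])
  rw [← hl, h]
  refine sum_congr rfl fun s _ => ?_
  rw [prod_const_one, one_mul]
  split_ifs with hs
  · rw [← prod_const]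
    refine prod_congr rfl fun a ha => ?_
    rw [if_neg]
    rintro ⟨i, rfl⟩
    exact (mem_compl.1 ha) (hs i)
  · obtain ⟨i, hi⟩ := not_forall.1 hs
    exact (prod_eq_zero (mem_compl.2 hi) (by simp)).symm

open Finset in
theorem MultilinearMap.sum_perm_eq_sum_neg_one_pow {ι V : Type*} [Fintype ι] [DecidableEq ι]
    [AddCommGroup V] [Module ℝ V] (L : MultilinearMap ℝ (fun _ : ι => V) ℝ) (v : ι → V) :
    ∑ σ : Equiv.Perm ι, L (fun i => v (σ i)) =
      ∑ s : Finset ι, (-1 : ℝ) ^ #sᶜ * L (fun _ => ∑ k ∈ s, v k) := by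
  have hs (s : Finset ι) : (-1 : ℝ) ^ #sᶜ * L (fun _ => ∑ k ∈ s, v k) =
      ∑ g : ι → ι, (if ∀ i, g i ∈ s then (-1 : ℝ) ^ #sᶜ else 0) * L (fun i => v (g i)) := by
    rw [L.map_sum_finset (fun _ k => v k) (fun _ => s), mul_sum]
    simp only [ite_mul, zero_mul]
    rw [← sum_filter]
    refine sum_congr ?_ fun _ _ => rfl
    ext g
    simp
  simp only [hs]
  rw [sum_comm]
  simp only [← sum_mul, sum_neg_one_pow_card_compl_of_range_subset]
  refine Fintype.sum_of_injective (fun σ : Equiv.Perm ι => (σ : ι → ι)) DFunLike.coe_injective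
    _ _ (fun g hg => ?_) fun σ => ?_
  · rw [if_neg, zero_mul]
    exact fun h => hg ⟨Equiv.ofBijective g ⟨Finite.injective_iff_surjective.2 h, h⟩, rfl⟩
  · rw [if_pos σ.surjective, one_mul]

theorem sum_pow_card_le_factorial_mul_choose (d : ℕ) :
    ∑ s : Finset (Fin d), s.card ^ d ≤ d.factorial * ((2 * d - 1).choose d * d ^ d) := by
  rcases Nat.lt_or_ge d 2 with hd | hd
  · interval_cases d <;> decide
  · have h1 : ∑ s : Finset (Fin d), s.card ^ d ≤ 2 ^ d * d ^ d := by
      refine (Finset.sum_le_card_nsmul _ _ (d ^ d) fun s _ => ?_).trans_eq (by simp)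
      exact Nat.pow_le_pow_left (by simpa using s.card_le_univ) d
    have h2 := Nat.pow_sub_le_descFactorial (2 * d - 1) d
    rw [Nat.descFactorial_eq_factorial_mul_choose, show 2 * d - 1 + 1 - d = d by omega] at h2
    rw [← mul_assoc]
    exact h1.trans (Nat.mul_le_mul_right _ ((Nat.pow_le_pow_left hd d).trans h2))

open Finset in
/-- Sampling coordinates independently: an injective tuple of samples has the product law. -/
theorem sum_prod_mul_comp_of_injective {α β κ : Type*} [Fintype α] [DecidableEq α] [Fintype β]
    [DecidableEq β] [Fintype κ] [DecidableEq κ] {x : κ → ℝ} (hx : ∑ i, x i = 1) {τ : α → β}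
    (hτ : τ.Injective) (Φ : (α → κ) → ℝ) :
    ∑ ω : β → κ, (∏ t, x (ω t)) * Φ (ω ∘ τ) = ∑ g : α → κ, (∏ m, x (g m)) * Φ g := by
  rw [← sum_fiberwise univ (fun ω : β → κ => ω ∘ τ)]
  refine sum_congr rfl fun g _ => ?_
  let A : β → Finset κ := Function.extend τ (fun m => {g m}) fun _ => univ
  have hA : ({ω | ω ∘ τ = g} : Finset (β → κ)) = Fintype.piFinset A := by
    ext ω
    simp only [mem_filter, mem_univ, true_and, Fintype.mem_piFinset]
    constructor
    · rintro rfl t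
      by_cases ht : ∃ m, τ m = t
      · obtain ⟨m, rfl⟩ := ht
        simp [A, hτ.extend_apply]
      · simp [A, Function.extend_apply' _ _ _ ht]
    · intro h
      ext m
      simpa [A, hτ.extend_apply] using h (τ m)
  have hsum : ∑ ω ∈ Fintype.piFinset A, ∏ t, x (ω t) = ∏ m, x (g m) := by
    rw [← prod_univ_sum A fun _ i => x i]
    refine (Fintype.prod_of_injective τ hτ _ _ (fun t ht => ?_) fun m => ?_).symm
    · simp [A, Function.extend_apply' _ _ _ ht, hx]
    · simp [A, hτ.extend_apply]
  rw [← hsum, ← hA, sum_mul]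
  refine sum_congr rfl fun ω hω => ?_
  rw [(mem_filter.1 hω).2]

theorem List.exists_multilinearMap_eq_prod {V : Type*} [AddCommGroup V] [Module ℝ V]
    (l : List (V →ₗ[ℝ] ℝ)) :
    ∃ L : MultilinearMap ℝ (fun _ : Fin l.length => V) ℝ,
      ∀ x, L (fun _ => x) = (l.map fun φ => φ x).prod := by
  refine ⟨(MultilinearMap.mkPiAlgebra ℝ (Fin l.length) ℝ).compLinearMap fun m => l.get m,
    fun x => ?_⟩
  simp only [MultilinearMap.compLinearMap_apply, MultilinearMap.mkPiAlgebra_apply]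
  rw [← List.prod_ofFn, ← List.ofFn_getElem_eq_map]
  rfl

/-- On the hyperplane `∑ i, x i = 1`, a polynomial of degree at most `d` is a `d`-form. -/
theorem MvPolynomial.exists_multilinearMap_eval_eq {κ : Type*} [Fintype κ] {d : ℕ}
    (f : MvPolynomial κ ℝ) (hf : f.totalDegree ≤ d) :
    ∃ L : MultilinearMap ℝ (fun _ : Fin d => κ → ℝ) ℝ,
      ∀ x : κ → ℝ, ∑ i, x i = 1 → L (fun _ => x) = eval x f := by
  have hmon (s : κ →₀ ℕ) (hs : (s.sum fun _ e => e) ≤ d) :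
      ∃ L : MultilinearMap ℝ (fun _ : Fin d => κ → ℝ) ℝ,
        ∀ x : κ → ℝ, ∑ i, x i = 1 → L (fun _ => x) = s.prod fun i e => x i ^ e := by
    let l : List ((κ → ℝ) →ₗ[ℝ] ℝ) :=
      (Finsupp.toMultiset s).toList.map (fun i => LinearMap.proj i) ++
        List.replicate (d - s.sum fun _ e => e) (∑ i, LinearMap.proj i)
    have hl : l.length = d := by
      simp only [l, List.length_append, List.length_map, Multiset.length_toList,
        Finsupp.card_toMultiset, List.length_replicate]
      exact Nat.add_sub_of_le hs
    have hprod (x : κ → ℝ) (hx : ∑ i, x i = 1) :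
        (l.map fun φ => φ x).prod = s.prod fun i e => x i ^ e := by
      have hcomp : (fun φ : (κ → ℝ) →ₗ[ℝ] ℝ => φ x) ∘
          (fun i => (LinearMap.proj i : (κ → ℝ) →ₗ[ℝ] ℝ)) = x := rfl
      simp only [l, List.map_append, List.map_map, List.prod_append, List.map_replicate,
        LinearMap.sum_apply, LinearMap.proj_apply, hx, List.prod_replicate, one_pow, mul_one,
        hcomp]
      rw [← Multiset.prod_coe, ← Multiset.map_coe, Multiset.coe_toList, Finsupp.toMultiset_map,
        Finsupp.prod_toMultiset, Finsupp.prod_mapDomain_index (by simp) (by simp [pow_add])]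
    obtain ⟨L, hL⟩ := l.exists_multilinearMap_eq_prod
    clear_value l
    subst hl
    exact ⟨L, fun x hx => (hL x).trans (hprod x hx)⟩
  choose! L hL using hmon
  refine ⟨∑ s ∈ f.support, f.coeff s • L s, fun x hx => ?_⟩
  rw [sum_apply, eval_eq']
  refine Finset.sum_congr rfl fun s hs => ?_
  rw [smul_apply, hL s ((le_totalDegree hs).trans hf) x hx, smul_eq_mul,
    Finsupp.prod_fintype _ _ (by simp)]

open Finset in
theorem MultilinearMap.sum_perm_le_of_diag_le {κ : Type*} [Fintype κ] {d : ℕ}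
    (L : MultilinearMap ℝ (fun _ : Fin d => κ → ℝ) ℝ) {M : ℝ}
    (hL : ∀ x ∈ stdSimplex ℝ κ, 0 ≤ L (fun _ => x) ∧ L (fun _ => x) ≤ M)
    {x₀ : κ → ℝ} (hx₀ : x₀ ∈ stdSimplex ℝ κ) {v : Fin d → κ → ℝ} (hv : ∀ k, v k ∈ stdSimplex ℝ κ) :
    ∑ σ : Equiv.Perm (Fin d), L (fun i => v (σ i)) ≤
      d.factorial * ((2 * d - 1).choose d * d ^ d * M) := by
  have hM : 0 ≤ M := (hL x₀ hx₀).1.trans (hL x₀ hx₀).2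
  have hs (s : Finset (Fin d)) :
      (-1 : ℝ) ^ #sᶜ * L (fun _ => ∑ k ∈ s, v k) ≤ (#s : ℝ) ^ d * M := by
    have habs : |L (fun _ => ∑ k ∈ s, v k)| ≤ (#s : ℝ) ^ d * M := by
      rcases s.eq_empty_or_nonempty with rfl | hne
      · rcases Nat.eq_zero_or_pos d with rfl | hd
        · rw [Subsingleton.elim (fun _ => ∑ k ∈ ∅, v k) fun _ : Fin 0 => x₀,
            abs_of_nonneg (hL x₀ hx₀).1, pow_zero, one_mul]
          exact (hL x₀ hx₀).2
        · rw [L.map_coord_zero ⟨0, hd⟩ sum_empty, abs_zero]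
          positivity
      · have hc : (#s : ℝ) ≠ 0 := Nat.cast_ne_zero.2 (card_ne_zero.2 hne)
        set y : κ → ℝ := (#s : ℝ)⁻¹ • ∑ k ∈ s, v k with hy
        have hmem : y ∈ stdSimplex ℝ κ := by
          rw [hy, smul_sum]
          exact (convex_stdSimplex ℝ κ).sum_mem (fun _ _ => by positivity)
            (by rw [sum_const, nsmul_eq_mul, mul_inv_cancel₀ hc]) fun k _ => hv k
        have hsy : ∑ k ∈ s, v k = (#s : ℝ) • y := by rw [hy, smul_inv_smul₀ hc]
        rw [hsy, L.map_smul_univ (fun _ => (#s : ℝ)) (fun _ => y)]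
        simp only [prod_const, card_univ, Fintype.card_fin, smul_eq_mul]
        have hpow : 0 ≤ (#s : ℝ) ^ d := pow_nonneg (Nat.cast_nonneg _) _
        rw [abs_of_nonneg (mul_nonneg hpow (hL y hmem).1)]
        exact mul_le_mul_of_nonneg_left (hL y hmem).2 hpow
    refine (le_abs_self _).trans ?_
    rwa [abs_mul, abs_pow, abs_neg, abs_one, one_pow, one_mul]
  rw [L.sum_perm_eq_sum_neg_one_pow]
  refine (sum_le_sum fun s _ => hs s).trans ?_
  rw [← sum_mul, ← mul_assoc]
  exact mul_le_mul_of_nonneg_right (mod_cast sum_pow_card_le_factorial_mul_choose d) hM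

open Finset in
theorem MultilinearMap.sum_not_injective_le {V : Type*} [AddCommGroup V] [Module ℝ V] {d r : ℕ}
    (L : MultilinearMap ℝ (fun _ : Fin d => V) ℝ) {K : ℝ} {v : Fin r → V}
    (hK : ∀ τ : Fin d → Fin r,
      ∑ σ : Equiv.Perm (Fin d), L (fun i => v (τ (σ i))) ≤ d.factorial * K) :
    ∑ τ : Fin d → Fin r with ¬ τ.Injective, L (fun i => v (τ i)) ≤
      (r ^ d - r.descFactorial d) * K := by
  have hcard : (#{τ : Fin d → Fin r | ¬ τ.Injective} : ℝ) = r ^ d - r.descFactorial d := by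
    have h1 : #{τ : Fin d → Fin r | τ.Injective} = r.descFactorial d := by
      rw [← Fintype.card_subtype, Fintype.card_congr (Equiv.subtypeInjectiveEquivEmbedding _ _),
        Fintype.card_embedding_eq, Fintype.card_fin, Fintype.card_fin]
    have h2 := card_filter_add_card_filter_not (s := univ) fun τ : Fin d → Fin r => τ.Injective
    rw [h1, card_univ, Fintype.card_fun, Fintype.card_fin, Fintype.card_fin] at h2
    rw [eq_sub_iff_add_eq']
    exact_mod_cast h2
  have hperm (σ : Equiv.Perm (Fin d)) :
      ∑ τ : Fin d → Fin r with ¬ τ.Injective, L (fun i => v (τ (σ i))) =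
        ∑ τ : Fin d → Fin r with ¬ τ.Injective, L (fun i => v (τ i)) :=
    sum_equiv (Equiv.arrowCongr σ.symm (Equiv.refl _))
      (fun τ => by
        simp only [mem_filter, mem_univ, true_and]
        exact not_congr (Function.Injective.of_comp_iff' τ σ.bijective).symm) fun τ _ => rfl
  have h := sum_le_sum fun (τ : Fin d → Fin r) (_ : τ ∈ ({τ | ¬ τ.Injective} : Finset _)) => hK τ
  rw [sum_comm] at h
  simp only [hperm, sum_const, card_univ, Fintype.card_perm, Fintype.card_fin, nsmul_eq_mul,
    hcard] at h
  refine le_of_mul_le_mul_left (h.trans_eq ?_) (Nat.cast_pos.2 d.factorial_pos)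
  ring

open Finset in
theorem MultilinearMap.exists_grid_diag_le {κ : Type*} [Fintype κ] [DecidableEq κ] {d r : ℕ}
    (hr : 1 ≤ r) (L : MultilinearMap ℝ (fun _ : Fin d => κ → ℝ) ℝ) {K : ℝ}
    (hK : ∀ v : Fin d → κ → ℝ, (∀ k, v k ∈ stdSimplex ℝ κ) →
      ∑ σ : Equiv.Perm (Fin d), L (fun i => v (σ i)) ≤ d.factorial * K)
    {x : κ → ℝ} (hx : x ∈ stdSimplex ℝ κ) (hLx : L (fun _ => x) = 0) :
    ∃ y ∈ stdSimplex ℝ κ, (∀ i, ∃ k : ℕ, (r : ℝ) * y i = k) ∧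
      L (fun _ => y) ≤ (1 - (r.descFactorial d : ℝ) / (r : ℝ) ^ d) * K := by
  have hr0 : (r : ℝ) ≠ 0 := by positivity
  let e : κ → κ → ℝ := fun i => Pi.single i 1
  let y : (Fin r → κ) → κ → ℝ := fun ω => (r : ℝ)⁻¹ • ∑ t, e (ω t)
  let w : (Fin r → κ) → ℝ := fun ω => ∏ t, x (ω t)
  have hw0 (ω) : 0 ≤ w ω := prod_nonneg fun t _ => hx.1 _
  have hw1 : ∑ ω, w ω = 1 := by
    simp only [w]
    rw [← Fintype.prod_sum fun (_ : Fin r) i => x i]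
    simp [hx.2]
  have he (i : κ) : e i ∈ stdSimplex ℝ κ := single_mem_stdSimplex ℝ i
  have hyL (ω) : L (fun _ => y ω) =
      (r ^ d : ℝ)⁻¹ * ∑ τ : Fin d → Fin r, L (fun m => e (ω (τ m))) := by
    simp only [y]
    rw [L.map_smul_univ (fun _ => (r : ℝ)⁻¹) (fun _ => ∑ t, e (ω t)),
      L.map_sum fun _ t => e (ω t)]
    simp
  have hinj (τ : Fin d → Fin r) (hτ : τ.Injective) :
      ∑ ω, w ω * L (fun m => e (ω (τ m))) = 0 := by
    have h := sum_prod_mul_comp_of_injective hx.2 hτ fun g => L (fun m => e (g m))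
    refine h.trans ?_
    rw [← hLx]
    have hxe : (fun _ : Fin d => x) = fun _ => ∑ i, x i • e i := by
      funext _
      simp [e, ← Pi.single_smul, Finset.univ_sum_single]
    rw [hxe, L.map_sum fun _ i => x i • e i]
    exact sum_congr rfl fun g _ => (L.map_smul_univ (fun m => x (g m)) _).symm
  have hnot (ω : Fin r → κ) := L.sum_not_injective_le (r := r) (v := fun t => e (ω t)) (K := K)
    fun τ => hK (fun i => e (ω (τ i))) fun _ => he _
  have havg : ∑ ω, w ω * L (fun _ => y ω) ≤
      ∑ ω, w ω * ((1 - (r.descFactorial d : ℝ) / (r : ℝ) ^ d) * K) := by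
    have hsplit (ω) : w ω * L (fun _ => y ω) =
        (r ^ d : ℝ)⁻¹ * (∑ τ : Fin d → Fin r with τ.Injective, w ω * L (fun m => e (ω (τ m)))) +
        w ω * ((r ^ d : ℝ)⁻¹ *
          ∑ τ : Fin d → Fin r with ¬ τ.Injective, L (fun m => e (ω (τ m)))) := by
      rw [hyL, ← sum_filter_add_sum_filter_not univ fun τ : Fin d → Fin r => τ.Injective,
        ← mul_sum]
      ring
    simp only [hsplit]
    rw [sum_add_distrib, ← mul_sum, sum_comm,
      sum_eq_zero fun τ hτ => hinj τ (mem_filter.1 hτ).2, mul_zero, zero_add]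
    refine sum_le_sum fun ω _ => mul_le_mul_of_nonneg_left ?_ (hw0 ω)
    refine (mul_le_mul_of_nonneg_left (hnot ω) (by positivity)).trans_eq ?_
    field_simp
  obtain ⟨ω, -, hω⟩ : ∃ ω ∈ (univ : Finset (Fin r → κ)), 0 < w ω ∧
      L (fun _ => y ω) ≤ (1 - (r.descFactorial d : ℝ) / (r : ℝ) ^ d) * K := by
    by_contra! hcon
    obtain ⟨ω₀, -, hω₀⟩ : ∃ ω ∈ (univ : Finset (Fin r → κ)), 0 < w ω :=
      exists_lt_of_sum_lt (by simp [hw1])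
    refine havg.not_gt (sum_lt_sum (fun ω hω => ?_) ⟨ω₀, mem_univ _, ?_⟩)
    · rcases (hw0 ω).eq_or_lt with h | h
      · simp [← h]
      · exact mul_le_mul_of_nonneg_left (hcon ω hω h).le h.le
    · exact mul_lt_mul_of_pos_left (hcon ω₀ (mem_univ _) hω₀) hω₀
  refine ⟨y ω, ?_, fun i => ⟨#{t | ω t = i}, ?_⟩, hω.2⟩
  · simp only [y, smul_sum]
    exact (convex_stdSimplex ℝ κ).sum_mem (fun _ _ => by positivity) (by simp [hr0])
      fun t _ => he _
  · simp [y, e, hr0, Finset.sum_apply, Pi.single_apply, eq_comm]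

theorem grid_search_degree_d (n d : ℕ) (f : MvPolynomial (Fin n) ℝ)
    (hf : f.totalDegree = d) (r : ℕ) (hr : 1 ≤ r) (fmin fmax fgrid : ℝ)
    (hmin : IsLeast ((fun x => eval x f) '' stdSimplex ℝ (Fin n)) fmin)
    (hmax : IsGreatest ((fun x => eval x f) '' stdSimplex ℝ (Fin n)) fmax)
    (hgrid : IsLeast ((fun x => eval x f) ''
      {x | x ∈ stdSimplex ℝ (Fin n) ∧ ∀ i, ∃ k : ℕ, (r : ℝ) * x i = k}) fgrid) :
    fgrid - fmin ≤
      (1 - (r.descFactorial d : ℝ) / (r : ℝ) ^ d) * ((2 * d - 1).choose d : ℝ) *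
        (d : ℝ) ^ d * (fmax - fmin) := by
  obtain ⟨L, hL⟩ := (f - C fmin).exists_multilinearMap_eval_eq (d := d)
    ((totalDegree_sub_C_le f fmin).trans_eq hf)
  simp only [map_sub, eval_C] at hL
  obtain ⟨x, hx, hxmin⟩ := hmin.1
  have hbound : ∀ y ∈ stdSimplex ℝ (Fin n),
      0 ≤ L (fun _ => y) ∧ L (fun _ => y) ≤ fmax - fmin := fun y hy => by
    rw [hL y hy.2]
    exact ⟨sub_nonneg.2 (hmin.2 ⟨y, hy, rfl⟩), sub_le_sub_right (hmax.2 ⟨y, hy, rfl⟩) _⟩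
  obtain ⟨y, hy, hygrid, hyL⟩ := L.exists_grid_diag_le hr
    (fun v hv => L.sum_perm_le_of_diag_le hbound hx hv) hx
    (by rw [hL x hx.2]; exact sub_eq_zero.2 hxmin)
  rw [hL y hy.2] at hyL
  refine (sub_le_sub_right (hgrid.2 ⟨y, ⟨hy, hygrid⟩, rfl⟩) fmin).trans (hyL.trans_eq ?_)
  ring
end

section
/- Let f be a quadratic polynomial in n variables, and suppose x* is a global minimizer of f over Δ_n with denominator m, i.e. m·x* ∈ ℕ^n. Then for all integers r ≥ 1, f_{min,Δ(n,r)} − f_{min,Δ_n} ≤ (m/r²)·(f_{max,Δ_n} − f_{min,Δ_n}). -/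
open MvPolynomial

/-- A multi-index of degree at most two is zero, a unit vector, or a sum of two unit vectors. -/
lemma Finsupp.eq_zero_or_single_or_add_of_degree_le_two {σ : Type*} (s : σ →₀ ℕ)
    (hs : s.sum (fun _ e => e) ≤ 2) :
    s = 0 ∨ (∃ a, s = Finsupp.single a 1) ∨
      ∃ a b, s = Finsupp.single a 1 + Finsupp.single b 1 := by
  classical
  replace hs : (Finsupp.toMultiset s).card ≤ 2 := (Finsupp.card_toMultiset s).trans_le hs
  have h : s = Multiset.toFinsupp (Finsupp.toMultiset s) := by simp
  generalize Finsupp.toMultiset s = t at hs h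
  subst h
  have hc : t.card = 0 ∨ t.card = 1 ∨ t.card = 2 := by omega
  rcases hc with hc | hc | hc
  · left
    simp [Multiset.card_eq_zero.mp hc]
  · right; left
    obtain ⟨a, rfl⟩ := Multiset.card_eq_one.mp hc
    exact ⟨a, by simp⟩
  · right; right
    obtain ⟨a, b, rfl⟩ := Multiset.card_eq_two.mp hc
    refine ⟨a, b, ?_⟩
    rw [Multiset.insert_eq_cons, ← Multiset.singleton_add, map_add]
    simp

/-- The average of a quadratic polynomial over the points `x + t (x - eᵢ)` with weights `xᵢ`. -/
lemma MvPolynomial.sum_mul_eval_add_smul_sub_single {n : ℕ} (f : MvPolynomial (Fin n) ℝ)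
    (hf : f.totalDegree ≤ 2) (x : Fin n → ℝ) (hx : ∑ i, x i = 1) (t : ℝ) :
    ∑ i, x i * eval (x + t • (x - Pi.single i 1)) f =
      eval x f + t ^ 2 * (∑ i, x i * eval (Pi.single i 1) f - eval x f) := by
  have key : ∀ s ∈ f.support,
      ∑ i, x i * eval (x + t • (x - Pi.single i 1)) (monomial s (coeff s f)) =
        eval x (monomial s (coeff s f)) +
          t ^ 2 * (∑ i, x i * eval (Pi.single i 1) (monomial s (coeff s f)) -
            eval x (monomial s (coeff s f))) := by
    intro s hs
    generalize coeff s f = c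
    have single_sum : ∀ a, ∑ i, x i * (Pi.single i 1 : Fin n → ℝ) a = x a := by
      intro a
      simp [Pi.single_apply]
    rcases Finsupp.eq_zero_or_single_or_add_of_degree_le_two s
      ((le_totalDegree hs).trans hf) with rfl | ⟨a, rfl⟩ | ⟨a, b, rfl⟩
    · simp [← Finset.sum_mul, hx]
    · have e : ∀ y : Fin n → ℝ, eval y (monomial (Finsupp.single a 1) c) = c * y a := by
        intro y
        simp [eval_monomial]
      simp only [e, Pi.add_apply, Pi.smul_apply, Pi.sub_apply, smul_eq_mul]
      have h1 : ∑ i, x i * (c * (Pi.single i 1 : Fin n → ℝ) a) = c * x a := by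
        rw [← single_sum a, Finset.mul_sum]
        exact Finset.sum_congr rfl fun i _ => by ring
      have h2 : ∑ i, x i * (c * (x a + t * (x a - (Pi.single i 1 : Fin n → ℝ) a))) =
          (c * (1 + t) * x a) * ∑ i, x i -
            t * ∑ i, x i * (c * (Pi.single i 1 : Fin n → ℝ) a) := by
        rw [Finset.mul_sum, Finset.mul_sum, ← Finset.sum_sub_distrib]
        exact Finset.sum_congr rfl fun i _ => by ring
      rw [h2, h1, hx]
      ring
    · have e : ∀ y : Fin n → ℝ,
          eval y (monomial (Finsupp.single a 1 + Finsupp.single b 1) c) = c * (y a * y b) := by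
        intro y
        rw [eval_monomial, Finsupp.prod_add_index' (by simp) (by intros; exact pow_add _ _ _)]
        simp
      simp only [e, Pi.add_apply, Pi.smul_apply, Pi.sub_apply, smul_eq_mul]
      have h2 : ∑ i, x i * (c * ((x a + t * (x a - (Pi.single i 1 : Fin n → ℝ) a)) *
            (x b + t * (x b - (Pi.single i 1 : Fin n → ℝ) b)))) =
          (c * (1 + t) ^ 2 * x a * x b) * ∑ i, x i
            - c * (1 + t) * t * x b * ∑ i, x i * (Pi.single i 1 : Fin n → ℝ) a
            - c * (1 + t) * t * x a * ∑ i, x i * (Pi.single i 1 : Fin n → ℝ) b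
            + t ^ 2 * ∑ i, x i * (c * ((Pi.single i 1 : Fin n → ℝ) a *
              (Pi.single i 1 : Fin n → ℝ) b)) := by
        simp only [Finset.mul_sum]
        rw [← Finset.sum_sub_distrib, ← Finset.sum_sub_distrib, ← Finset.sum_add_distrib]
        exact Finset.sum_congr rfl fun i _ => by ring
      rw [h2, single_sum, single_sum, hx]
      ring
  have he : ∀ y : Fin n → ℝ,
      eval y f = ∑ s ∈ f.support, eval y (monomial s (coeff s f)) := by
    intro y
    conv_lhs => rw [f.as_sum]
    rw [map_sum]
  simp only [he, Finset.mul_sum]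
  rw [Finset.sum_comm, Finset.sum_comm (s := Finset.univ) (t := f.support),
    ← Finset.sum_sub_distrib, Finset.mul_sum, ← Finset.sum_add_distrib]
  refine Finset.sum_congr rfl fun s hs => ?_
  simpa only [Finset.mul_sum] using key s hs

/-- The points of the standard simplex all of whose coordinates have denominator `r`. -/
def simplexGrid (n r : ℕ) : Set (Fin n → ℝ) :=
  {x | x ∈ stdSimplex ℝ (Fin n) ∧ ∀ i, ∃ k : ℕ, (r : ℝ) * x i = k}

lemma add_inv_smul_sub_single_mem_simplexGrid {n M : ℕ} (hM : 1 ≤ M) {x : Fin n → ℝ}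
    (hx : x ∈ simplexGrid n (M + 1)) {i : Fin n} (hi : 0 < x i) :
    x + (M : ℝ)⁻¹ • (x - Pi.single i 1) ∈ simplexGrid n M := by
  obtain ⟨⟨-, hsum⟩, hk⟩ := hx
  have hM0 : (0 : ℝ) < M := by exact_mod_cast hM
  have grid : ∀ a, ∃ k : ℕ, (M : ℝ) * (x + (M : ℝ)⁻¹ • (x - Pi.single i 1) : Fin n → ℝ) a = k := by
    intro a
    obtain ⟨k, hka⟩ := hk a
    have e : (M : ℝ) * (x + (M : ℝ)⁻¹ • (x - Pi.single i 1) : Fin n → ℝ) a =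
        k - (Pi.single i 1 : Fin n → ℝ) a := by
      rw [← hka]
      simp only [Pi.add_apply, Pi.smul_apply, Pi.sub_apply, smul_eq_mul]
      push_cast
      field_simp
      ring
    rw [e]
    rcases eq_or_ne a i with rfl | hai
    · have hk1 : 1 ≤ k := by
        have : (0 : ℝ) < k := by
          rw [← hka]
          positivity
        exact_mod_cast this
      exact ⟨k - 1, by rw [Pi.single_eq_same]; push_cast [hk1]; rfl⟩
    · exact ⟨k, by rw [Pi.single_eq_of_ne hai, sub_zero]⟩
  refine ⟨⟨fun a => ?_, ?_⟩, grid⟩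
  · obtain ⟨k, hka⟩ := grid a
    refine (mul_nonneg_iff_of_pos_left hM0).mp ?_
    rw [hka]
    positivity
  · simp [Finset.sum_add_distrib, ← Finset.mul_sum, Finset.sum_sub_distrib, hsum]

section

variable {n : ℕ} {f : MvPolynomial (Fin n) ℝ} {fmax : ℝ}

lemma exists_simplexGrid_succ_step (hf : f.totalDegree ≤ 2)
    (hmax : ∀ y ∈ stdSimplex ℝ (Fin n), eval y f ≤ fmax) {M : ℕ} (hM : 1 ≤ M)
    {x : Fin n → ℝ} (hx : x ∈ simplexGrid n (M + 1)) :
    ∃ y ∈ simplexGrid n M,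
      ((M : ℝ) + 1) * (M - 1) * (fmax - eval x f) ≤ (M : ℝ) ^ 2 * (fmax - eval y f) := by
  obtain ⟨hnn, hsum⟩ := hx.1
  have hM0 : (0 : ℝ) < M := by exact_mod_cast hM
  by_contra! hcon
  have avg := sum_mul_eval_add_smul_sub_single f hf x hsum (M : ℝ)⁻¹
  set y : Fin n → Fin n → ℝ := fun i => x + (M : ℝ)⁻¹ • (x - Pi.single i 1) with hy
  set c : ℝ := ((M : ℝ) + 1) * (M - 1) * (fmax - eval x f) with hc
  have hlt : ∑ i, x i * ((M : ℝ) ^ 2 * (fmax - eval (y i) f)) < ∑ i, x i * c := by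
    refine Finset.sum_lt_sum (fun i _ => ?_) ?_
    · rcases (hnn i).eq_or_lt with h0 | h0
      · simp [← h0]
      · exact mul_le_mul_of_nonneg_left
          (hcon _ (add_inv_smul_sub_single_mem_simplexGrid hM hx h0)).le h0.le
    · have : ∃ i ∈ Finset.univ, 0 < x i := by
        apply Finset.exists_lt_of_sum_lt
        simp [hsum]
      obtain ⟨i, -, h0⟩ := this
      exact ⟨i, Finset.mem_univ i, mul_lt_mul_of_pos_left
          (hcon _ (add_inv_smul_sub_single_mem_simplexGrid hM hx h0)) h0⟩
  have e1 : ∑ i, x i * ((M : ℝ) ^ 2 * (fmax - eval (y i) f)) =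
      (M : ℝ) ^ 2 * (fmax * ∑ i, x i - ∑ i, x i * eval (y i) f) := by
    rw [Finset.mul_sum, ← Finset.sum_sub_distrib, Finset.mul_sum]
    exact Finset.sum_congr rfl fun i _ => by ring
  rw [e1, avg, ← Finset.sum_mul, hsum] at hlt
  have hL : ∑ i, x i * eval (Pi.single i 1) f ≤ fmax := by
    calc ∑ i, x i * eval (Pi.single i 1) f ≤ ∑ i, x i * fmax :=
          Finset.sum_le_sum fun i _ =>
            mul_le_mul_of_nonneg_left (hmax _ (single_mem_stdSimplex ℝ i)) (hnn i)
      _ = fmax := by rw [← Finset.sum_mul, hsum, one_mul]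
  have e2 : (M : ℝ) ^ 2 * (fmax * 1 - (eval x f + (M : ℝ)⁻¹ ^ 2 *
      (∑ i, x i * eval (Pi.single i 1) f - eval x f))) =
      (M : ℝ) ^ 2 * (fmax - eval x f) - (∑ i, x i * eval (Pi.single i 1) f - eval x f) := by
    field_simp
    ring
  rw [e2, hc] at hlt
  linarith

lemma exists_simplexGrid_of_le (hf : f.totalDegree ≤ 2)
    (hmax : ∀ y ∈ stdSimplex ℝ (Fin n), eval y f ≤ fmax) {r M : ℕ} (hr : 1 ≤ r) (hrM : r ≤ M)
    {x : Fin n → ℝ} (hx : x ∈ simplexGrid n M) :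
    ∃ z ∈ simplexGrid n r,
      (M : ℝ) * (r - 1) * (fmax - eval x f) ≤ r * (M - 1) * (fmax - eval z f) := by
  induction M, hrM using Nat.le_induction generalizing x with
  | base => exact ⟨x, hx, le_rfl⟩
  | succ M hrM ih =>
    obtain ⟨y, hy, hxy⟩ := exists_simplexGrid_succ_step hf hmax (hr.trans hrM) hx
    obtain ⟨z, hz, hyz⟩ := ih hy
    refine ⟨z, hz, ?_⟩
    have hDz : 0 ≤ fmax - eval z f := sub_nonneg.mpr (hmax z hz.1)
    have hr1 : (0 : ℝ) ≤ r - 1 := sub_nonneg.mpr (by exact_mod_cast hr)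
    push_cast
    rcases (hr.trans hrM).eq_or_lt with h1 | h1
    · obtain rfl : r = 1 := by omega
      simp only [Nat.cast_one, sub_self, mul_zero, zero_mul]
      rw [add_sub_cancel_right]
      positivity
    · have hM1 : (0 : ℝ) < M - 1 := sub_pos.mpr (by exact_mod_cast h1)
      refine le_of_mul_le_mul_left ?_ hM1
      have hM0 : (0 : ℝ) ≤ M := Nat.cast_nonneg M
      have a := mul_le_mul_of_nonneg_left hxy hr1
      have b := mul_le_mul_of_nonneg_left hyz hM0
      linarith

end

theorem grid_search_quadratic_rational_minimizer (n : ℕ) (f : MvPolynomial (Fin n) ℝ)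
    (hf : f.totalDegree ≤ 2) (xstar : Fin n → ℝ)
    (hxs : xstar ∈ stdSimplex ℝ (Fin n))
    (hxsmin : ∀ y ∈ stdSimplex ℝ (Fin n), eval xstar f ≤ eval y f)
    (m : ℕ) (hm : 1 ≤ m) (hdenom : ∀ i, ∃ k : ℕ, (m : ℝ) * xstar i = k)
    (r : ℕ) (hr : 1 ≤ r) (fmax fgrid : ℝ)
    (hmax : IsGreatest ((fun x => eval x f) '' stdSimplex ℝ (Fin n)) fmax)
    (hgrid : IsLeast ((fun x => eval x f) ''
      {x | x ∈ stdSimplex ℝ (Fin n) ∧ ∀ i, ∃ k : ℕ, (r : ℝ) * x i = k}) fgrid) :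
    fgrid - eval xstar f ≤ ((m : ℝ) / (r : ℝ) ^ 2) * (fmax - eval xstar f) := by
  have hle : ∀ y ∈ stdSimplex ℝ (Fin n), eval y f ≤ fmax :=
    fun y hy => hmax.2 ⟨y, hy, rfl⟩
  have hge : ∀ z ∈ simplexGrid n r, fgrid ≤ eval z f := fun z hz => hgrid.2 ⟨z, hz, rfl⟩
  have hD : 0 ≤ fmax - eval xstar f := sub_nonneg.mpr (hle _ hxs)
  obtain ⟨q, hq1, hq2⟩ : ∃ q, r ≤ m * q ∧ m * q < r + m := by
    refine ⟨(r + m - 1) / m, ?_, ?_⟩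
    · have := Nat.lt_mul_div_succ (r + m - 1) hm
      rw [Nat.mul_add] at this
      omega
    · have := Nat.mul_div_le (r + m - 1) m
      omega
  have hxM : xstar ∈ simplexGrid n (m * q) := by
    refine ⟨hxs, fun i => ?_⟩
    obtain ⟨k, hk⟩ := hdenom i
    exact ⟨q * k, by push_cast; rw [← hk]; ring⟩
  generalize m * q = M at hq1 hq2 hxM
  have hr0 : (0 : ℝ) < r := by exact_mod_cast hr
  rcases hq1.eq_or_lt with rfl | hlt
  · have h := hge _ hxM
    have : 0 ≤ (m : ℝ) / (r : ℝ) ^ 2 * (fmax - eval xstar f) := by positivity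
    linarith
  · obtain ⟨z, hz, hxz⟩ := exists_simplexGrid_of_le hf hle hr hq1 hxM
    have hM1 : (r : ℝ) ≤ M - 1 := by
      have : (r : ℝ) + 1 ≤ M := by exact_mod_cast hlt
      linarith
    have hM2 : (M : ℝ) - r ≤ m := by
      have : (M : ℝ) ≤ r + m := by exact_mod_cast hq2.le
      linarith
    have hz0 : 0 ≤ eval z f - eval xstar f := sub_nonneg.mpr (hxsmin z hz.1)
    refine (sub_le_sub_right (hge z hz) _).trans ?_
    rw [div_mul_eq_mul_div, le_div_iff₀ (by positivity)]
    calc (eval z f - eval xstar f) * (r : ℝ) ^ 2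
        = r * r * (eval z f - eval xstar f) := by ring
      _ ≤ r * (M - 1) * (eval z f - eval xstar f) := by gcongr
      _ ≤ (M - r) * (fmax - eval xstar f) := by linarith
      _ ≤ m * (fmax - eval xstar f) := by gcongr
end

section
/- Let f be a polynomial of degree d in n variables, and suppose f has a rational global minimizer over Δ_n lying in Δ(n,m) for some integer m ≥ 1. Then for all integers r ≥ 1, f_{min,Δ(n,r)} − f_{min,Δ_n} ≤ (m·c_d/r²)·(f_{max,Δ_n} − f_{min,Δ_n}), where c_d = (d−1)(d!−1)·d^{2d−1}·C(2d−1,d). -/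
open MvPolynomial

/-- The second-order Taylor remainder at `0` of a real polynomial, evaluated at `t`. -/
noncomputable def taylorRemainder (t : ℝ) : Polynomial ℝ →ₗ[ℝ] ℝ :=
  Polynomial.leval t - Polynomial.lcoeff ℝ 0 - t • Polynomial.lcoeff ℝ 1

theorem taylorRemainder_apply (t : ℝ) (q : Polynomial ℝ) :
    taylorRemainder t q = q.eval t - q.coeff 0 - t * q.coeff 1 := by
  simp [taylorRemainder]

theorem taylorRemainder_eq_zero_of_natDegree_le_one (t : ℝ) {q : Polynomial ℝ}
    (hq : q.natDegree ≤ 1) : taylorRemainder t q = 0 := by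
  rw [taylorRemainder_apply, Polynomial.eval_eq_sum_range' (Nat.lt_succ_of_le hq)]
  simp [Finset.sum_range_succ]
  ring

theorem abs_taylorRemainder_le_of_coeff_nonneg {t : ℝ} (ht : 0 ≤ t) (ht1 : t ≤ 1)
    {q : Polynomial ℝ} (hq : ∀ k, 0 ≤ q.coeff k) :
    |taylorRemainder t q| ≤ t ^ 2 * q.eval 1 := by
  have hdeg : q.natDegree < q.natDegree + 2 := by omega
  have key : taylorRemainder t q =
      ∑ i ∈ Finset.range q.natDegree, q.coeff (i + 2) * t ^ (i + 2) := by
    rw [taylorRemainder_apply, Polynomial.eval_eq_sum_range' hdeg, Finset.sum_range_succ',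
      Finset.sum_range_succ']
    simp
    ring
  rw [key, abs_of_nonneg (Finset.sum_nonneg fun i _ => mul_nonneg (hq _) (pow_nonneg ht _)),
    Polynomial.eval_eq_sum_range' hdeg, Finset.sum_range_succ', Finset.sum_range_succ']
  have h1 : ∑ i ∈ Finset.range q.natDegree, q.coeff (i + 2) * t ^ (i + 2) ≤
      t ^ 2 * ∑ i ∈ Finset.range q.natDegree, q.coeff (i + 2) := by
    rw [Finset.mul_sum]
    refine Finset.sum_le_sum fun i _ => ?_
    have h2 : t ^ (i + 2) ≤ t ^ 2 := pow_le_pow_of_le_one ht ht1 (by omega)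
    nlinarith [mul_le_mul_of_nonneg_left h2 (hq (i + 2))]
  have h3 : 0 ≤ t ^ 2 * (q.coeff 0 + q.coeff 1) :=
    mul_nonneg (sq_nonneg t) (add_nonneg (hq 0) (hq 1))
  simp only [one_pow, mul_one, add_assoc, zero_add, Nat.reduceAdd] at *
  linarith

theorem Polynomial.coeff_prod_nonneg {ι : Type*} (s : Finset ι) (p : ι → Polynomial ℝ)
    (hp : ∀ i ∈ s, ∀ k, 0 ≤ (p i).coeff k) (k : ℕ) : 0 ≤ (∏ i ∈ s, p i).coeff k := by
  classical
  induction s using Finset.induction_on generalizing k with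
  | empty =>
    rw [Finset.prod_empty, Polynomial.coeff_one]
    split_ifs <;> norm_num
  | insert a s ha ih =>
    rw [Finset.prod_insert ha, Polynomial.coeff_mul]
    exact Finset.sum_nonneg fun x _ => mul_nonneg (hp a (by simp) _)
      (ih (fun i hi => hp i (by simp [hi])) _)

theorem prod_range_erase_abs_sub (d i : ℕ) (hi : i ≤ d) :
    ∏ j ∈ (Finset.range (d + 1)).erase i, |(j : ℝ) - i| =
      i.factorial * (d - i).factorial := by
  induction d, hi using Nat.le_induction with
  | base =>
    rw [Finset.range_add_one, Finset.erase_insert (by simp), ← Finset.prod_range_reflect,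
      ← Finset.prod_range_add_one_eq_factorial]
    push_cast
    simp only [Nat.sub_self, Nat.factorial_zero, Nat.cast_one, mul_one]
    refine Finset.prod_congr rfl fun j hj => ?_
    have hj' : j < i := Finset.mem_range.1 hj
    rw [Nat.sub_sub, Nat.cast_sub (by omega), abs_of_nonpos (by push_cast; linarith)]
    push_cast
    ring
  | succ d hid ih =>
    rw [Finset.range_add_one, Finset.erase_insert_of_ne (by omega),
      Finset.prod_insert (by simp), ih, Nat.succ_sub hid, Nat.factorial_succ]
    have h : (i : ℝ) ≤ d := by exact_mod_cast hid
    rw [abs_of_nonneg (by push_cast; linarith)]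
    push_cast [Nat.cast_sub hid]
    ring

theorem prod_range_erase_add_le (d i : ℕ) (hd : 1 ≤ d) (hi : i ≤ d) :
    ∏ j ∈ (Finset.range (d + 1)).erase i, (d + j) ≤ d.factorial * (2 * d).choose d := by
  have h1 := Finset.mul_prod_erase (Finset.range (d + 1)) (fun j => d + j)
    (Finset.mem_range.2 (Nat.lt_succ_of_le hi))
  have h2 : ∏ j ∈ Finset.range (d + 1), (d + j) = d * (d.factorial * (2 * d).choose d) := by
    rw [Finset.prod_range_succ', two_mul, ← Nat.ascFactorial_eq_factorial_mul_choose,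
      Nat.ascFactorial_eq_prod_range, mul_comm, add_zero]
    congr 1
    exact Finset.prod_congr rfl fun j _ => by ring
  rw [h2] at h1
  refine Nat.le_of_mul_le_mul_left ?_ (show 0 < d by omega)
  rw [← h1]
  exact Nat.mul_le_mul_right _ (Nat.le_add_right _ _)

theorem abs_taylorRemainder_basis_le {t : ℝ} (ht : 0 ≤ t) (ht1 : t ≤ 1) (d i : ℕ) (hd : 1 ≤ d)
    (hi : i ≤ d) :
    |taylorRemainder t (Lagrange.basis (Finset.range (d + 1)) (fun j : ℕ => -(j : ℝ) / d) i)| ≤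
      t ^ 2 * ((2 * d).choose d * d.choose i) := by
  have hd0 : (0 : ℝ) < d := by exact_mod_cast hd
  set s := (Finset.range (d + 1)).erase i with hs
  set q : Polynomial ℝ := ∏ j ∈ s, (Polynomial.X + Polynomial.C ((j : ℝ) / d)) with hq
  set a : ℝ := ∏ j ∈ s, (-(i : ℝ) / d - -(j : ℝ) / d)⁻¹ with ha
  have hbasis : Lagrange.basis (Finset.range (d + 1)) (fun j : ℕ => -(j : ℝ) / d) i = a • q := by
    rw [Lagrange.basis, ← hs, ha, hq, Polynomial.smul_eq_C_mul, map_prod,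
      ← Finset.prod_mul_distrib]
    refine Finset.prod_congr rfl fun j _ => ?_
    rw [Lagrange.basisDivisor, neg_div (d : ℝ) (j : ℝ), Polynomial.C_neg,
      sub_neg_eq_add Polynomial.X]
  have hq0 : ∀ k, 0 ≤ q.coeff k := by
    refine Polynomial.coeff_prod_nonneg _ _ fun j _ k => ?_
    have : 0 ≤ (j : ℝ) / d := by positivity
    rw [Polynomial.coeff_add, Polynomial.coeff_X, Polynomial.coeff_C]
    split_ifs <;> linarith
  have hprod : |a| * q.eval 1 ≤ (2 * d).choose d * d.choose i := by
    have h1 : |a| * q.eval 1 = (∏ j ∈ s, ((d + j : ℕ) : ℝ)) / ∏ j ∈ s, |(j : ℝ) - i| := by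
      rw [ha, hq, Finset.abs_prod, Polynomial.eval_prod, ← Finset.prod_mul_distrib,
        ← Finset.prod_div_distrib]
      refine Finset.prod_congr rfl fun j _ => ?_
      have h : -(i : ℝ) / d - -(j : ℝ) / d = (j - i) / d := by ring
      rw [h, abs_inv, abs_div, abs_of_pos hd0]
      simp only [Polynomial.eval_add, Polynomial.eval_X, Polynomial.eval_C]
      push_cast
      field_simp
    rw [h1, hs, prod_range_erase_abs_sub d i hi, div_le_iff₀ (by positivity), ← Nat.cast_prod]
    have h2 := prod_range_erase_add_le d i hd hi
    rw [← Nat.choose_mul_factorial_mul_factorial hi] at h2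
    calc _ ≤ ((d.choose i * i.factorial * (d - i).factorial * (2 * d).choose d : ℕ) : ℝ) := by
          exact_mod_cast h2
      _ = _ := by push_cast; ring
  rw [hbasis, map_smul, smul_eq_mul, abs_mul]
  calc |a| * |taylorRemainder t q| ≤ |a| * (t ^ 2 * q.eval 1) :=
        mul_le_mul_of_nonneg_left (abs_taylorRemainder_le_of_coeff_nonneg ht ht1 hq0)
          (abs_nonneg a)
    _ = t ^ 2 * (|a| * q.eval 1) := by ring
    _ ≤ _ := mul_le_mul_of_nonneg_left hprod (sq_nonneg t)

/-- Lagrange interpolation at `0, -1/d, …, -1` bounds the Taylor remainder of a polynomial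
through its range on `[-1, 0]`. -/
theorem taylorRemainder_le_of_mem_Icc {t : ℝ} (ht : 0 ≤ t) (ht1 : t ≤ 1) {d : ℕ} (hd : 1 ≤ d)
    {g : Polynomial ℝ} (hg : g.natDegree ≤ d) {A B : ℝ}
    (hAB : ∀ u ∈ Set.Icc (-1 : ℝ) 0, g.eval u ∈ Set.Icc A B) :
    taylorRemainder t g ≤ t ^ 2 * ((2 * d).choose d * 2 ^ d * (B - A)) := by
  have hd0 : (0 : ℝ) < d := by exact_mod_cast hd
  set v : ℕ → ℝ := fun j => -(j : ℝ) / d with hv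
  have hinj : Set.InjOn v (Finset.range (d + 1)) := by
    intro x _ y _ hxy
    have h : -(x : ℝ) / d = -(y : ℝ) / d := hxy
    rw [div_left_inj' hd0.ne', neg_inj] at h
    exact_mod_cast h
  set p := g - Polynomial.C A with hp
  have hpdeg : p.degree < (Finset.range (d + 1)).card := by
    rw [Finset.card_range]
    refine lt_of_le_of_lt Polynomial.degree_le_natDegree ?_
    rw [hp, Polynomial.natDegree_sub_C]
    exact_mod_cast Nat.lt_succ_of_le hg
  have hgp : taylorRemainder t g = taylorRemainder t p := by
    rw [hp, map_sub, taylorRemainder_eq_zero_of_natDegree_le_one t (q := Polynomial.C A) (by simp),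
      sub_zero]
  rw [hgp, Lagrange.eq_interpolate hinj hpdeg, Lagrange.interpolate_apply, map_sum]
  have hbd : ∀ i ∈ Finset.range (d + 1),
      taylorRemainder t (Polynomial.C (p.eval (v i)) * Lagrange.basis (Finset.range (d + 1)) v i) ≤
        (t ^ 2 * ((2 * d).choose d * (B - A))) * d.choose i := by
    intro i hi
    have hid : i ≤ d := Nat.lt_succ_iff.1 (Finset.mem_range.1 hi)
    have hid' : (i : ℝ) ≤ d := by exact_mod_cast hid
    have hvi : v i ∈ Set.Icc (-1 : ℝ) 0 := by
      have h1 : (i : ℝ) / d ≤ 1 := (div_le_one hd0).2 hid'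
      have h2 : 0 ≤ (i : ℝ) / d := by positivity
      rw [hv]
      simp only [neg_div]
      constructor <;> linarith
    have hpv : 0 ≤ p.eval (v i) ∧ p.eval (v i) ≤ B - A := by
      have h := hAB _ hvi
      rw [hp, Polynomial.eval_sub, Polynomial.eval_C]
      exact ⟨by linarith [h.1], by linarith [h.2]⟩
    have hb := abs_taylorRemainder_basis_le ht ht1 d i hd hid
    rw [← Polynomial.smul_eq_C_mul, map_smul, smul_eq_mul]
    calc _ ≤ p.eval (v i) * |taylorRemainder t (Lagrange.basis (Finset.range (d + 1)) v i)| :=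
          mul_le_mul_of_nonneg_left (le_abs_self _) hpv.1
      _ ≤ (B - A) * (t ^ 2 * ((2 * d).choose d * d.choose i)) :=
          mul_le_mul hpv.2 hb (abs_nonneg _) (hpv.1.trans hpv.2)
      _ = _ := by ring
  refine (Finset.sum_le_sum hbd).trans (le_of_eq ?_)
  rw [← Finset.mul_sum, ← Nat.cast_sum, Nat.sum_range_choose]
  push_cast
  ring

theorem choose_mul_two_pow_le (d : ℕ) (hd : 2 ≤ d) :
    (2 * d).choose d * 2 ^ d ≤
      (d - 1) * (d.factorial - 1) * d ^ (2 * d - 1) * (2 * d - 1).choose d := by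
  have hch : (2 * d).choose d = 2 * (2 * d - 1).choose d := by
    obtain ⟨e, rfl⟩ : ∃ e, d = e + 1 := ⟨d - 1, by omega⟩
    have h := Nat.choose_succ_succ (2 * e + 1) e
    have h' := Nat.choose_symm_half e
    have e1 : 2 * (e + 1) = 2 * e + 1 + 1 := by ring
    rw [e1, Nat.add_sub_cancel, h, Nat.succ_eq_add_one, h', ← two_mul]
  have hfac : 2 ≤ d.factorial := hd.trans (Nat.self_le_factorial d)
  have hpow : 2 ^ (d + 1) ≤ d ^ (2 * d - 1) :=
    (Nat.pow_le_pow_right (by norm_num) (by omega)).trans (Nat.pow_le_pow_left hd _)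
  have hone : 1 ≤ (d - 1) * (d.factorial - 1) :=
    Nat.mul_pos (by omega) (by omega)
  rw [hch]
  calc 2 * (2 * d - 1).choose d * 2 ^ d = 1 * 2 ^ (d + 1) * (2 * d - 1).choose d := by ring
    _ ≤ _ := Nat.mul_le_mul_right _ (Nat.mul_le_mul hone hpow)

theorem taylorRemainder_le {t : ℝ} (ht : 0 ≤ t) (ht1 : t ≤ 1) {d : ℕ}
    {g : Polynomial ℝ} (hg : g.natDegree ≤ d) {A B : ℝ}
    (hAB : ∀ u ∈ Set.Icc (-1 : ℝ) 0, g.eval u ∈ Set.Icc A B) :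
    taylorRemainder t g ≤ t ^ 2 * ((((d - 1) * (d.factorial - 1) * d ^ (2 * d - 1) *
      (2 * d - 1).choose d : ℕ) : ℝ) * (B - A)) := by
  have h0 := hAB 0 (by simp)
  have hBA : 0 ≤ B - A := by linarith [h0.1, h0.2]
  rcases Nat.lt_or_ge d 2 with hd | hd
  · rw [taylorRemainder_eq_zero_of_natDegree_le_one t (by omega)]
    exact mul_nonneg (sq_nonneg t) (mul_nonneg (Nat.cast_nonneg _) hBA)
  · refine (taylorRemainder_le_of_mem_Icc ht ht1 (by omega) hg hAB).trans ?_
    refine mul_le_mul_of_nonneg_left (mul_le_mul_of_nonneg_right ?_ hBA) (sq_nonneg t)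
    exact_mod_cast choose_mul_two_pow_le d hd

section Line

variable {σ : Type*}

/-- The restriction of a multivariate polynomial to the line through `y` with direction `v`. -/
noncomputable def restrictLine (f : MvPolynomial σ ℝ) (y v : σ → ℝ) : Polynomial ℝ :=
  aeval (fun i => Polynomial.C (v i) * Polynomial.X + Polynomial.C (y i)) f

theorem eval_restrictLine (f : MvPolynomial σ ℝ) (y v : σ → ℝ) (t : ℝ) :
    (restrictLine f y v).eval t = eval (fun i => y i + t * v i) f := by
  unfold restrictLine
  induction f using MvPolynomial.induction_on with
  | C a => simp
  | add p q hp hq => simp [hp, hq]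
  | mul_X p i hp =>
    simp [hp]
    left
    ring

theorem natDegree_restrictLine_le (f : MvPolynomial σ ℝ) (y v : σ → ℝ) :
    (restrictLine f y v).natDegree ≤ f.totalDegree := by
  simpa [restrictLine] using aeval_natDegree_le f le_rfl
    (fun i => Polynomial.C (v i) * Polynomial.X + Polynomial.C (y i))
    (fun i => Polynomial.natDegree_linear_le)

theorem coeff_zero_restrictLine (f : MvPolynomial σ ℝ) (y v : σ → ℝ) :
    (restrictLine f y v).coeff 0 = eval y f := by
  rw [Polynomial.coeff_zero_eq_eval_zero, eval_restrictLine]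
  simp

theorem exists_coeff_one_restrictLine [Fintype σ] (f : MvPolynomial σ ℝ) (y : σ → ℝ) :
    ∃ c : σ → ℝ, ∀ v, (restrictLine f y v).coeff 1 = ∑ i, c i * v i := by
  classical
  induction f using MvPolynomial.induction_on with
  | C a => exact ⟨0, fun v => by simp [restrictLine]⟩
  | add p q hp hq =>
    obtain ⟨c, hc⟩ := hp
    obtain ⟨c', hc'⟩ := hq
    refine ⟨c + c', fun v => ?_⟩
    rw [restrictLine, map_add, Polynomial.coeff_add]
    simp only [Pi.add_apply, add_mul, Finset.sum_add_distrib]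
    rw [← hc, ← hc']
    rfl
  | mul_X p i hp =>
    obtain ⟨c, hc⟩ := hp
    refine ⟨fun j => y i * c j + eval y p * (if j = i then 1 else 0), fun v => ?_⟩
    have h : restrictLine (p * X i) y v = Polynomial.C (v i) * restrictLine p y v * Polynomial.X +
        Polynomial.C (y i) * restrictLine p y v := by
      simp only [restrictLine, map_mul, aeval_X]
      ring
    rw [h, Polynomial.coeff_add, Polynomial.coeff_mul_X, Polynomial.coeff_C_mul,
      Polynomial.coeff_C_mul, hc, coeff_zero_restrictLine]
    simp only [add_mul, Finset.sum_add_distrib, mul_assoc, ← Finset.mul_sum]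
    simp
    ring

end Line

/-- Removing one well-chosen unit from a point of the grid with denominator `s + 1` gives a point
of the grid with denominator `s` where the polynomial increases by `O(1 / s ^ 2)`. -/
theorem exists_grid_point_of_grid_succ {n d : ℕ} {f : MvPolynomial (Fin n) ℝ}
    (hf : f.totalDegree = d) {A B : ℝ}
    (hAB : ∀ z ∈ stdSimplex ℝ (Fin n), eval z f ∈ Set.Icc A B)
    {s : ℕ} (hs : 1 ≤ s) {y : Fin n → ℝ} (hy : y ∈ stdSimplex ℝ (Fin n))
    (hgrid : ∀ i, ∃ k : ℕ, ((s + 1 : ℕ) : ℝ) * y i = k) :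
    ∃ z ∈ stdSimplex ℝ (Fin n), (∀ i, ∃ k : ℕ, (s : ℝ) * z i = k) ∧
      eval z f ≤ eval y f + (((d - 1) * (d.factorial - 1) * d ^ (2 * d - 1) *
        (2 * d - 1).choose d : ℕ) : ℝ) * (B - A) / (s : ℝ) ^ 2 := by
  have hs1 : (1 : ℝ) ≤ s := by exact_mod_cast hs
  have hs0 : (0 : ℝ) < s := by linarith
  obtain ⟨hy0, hy1⟩ := hy
  obtain ⟨c, hc⟩ := exists_coeff_one_restrictLine f y
  obtain ⟨j, hj, hcj⟩ : ∃ j, 0 < y j ∧ ∑ i, c i * y i ≤ c j := by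
    by_contra! hcon
    obtain ⟨j, -, hj⟩ : ∃ j ∈ Finset.univ, (0 : ℝ) < y j :=
      Finset.exists_lt_of_sum_lt (by simp [hy1])
    have hlt : ∑ i, c i * y i < ∑ i, (∑ l, c l * y l) * y i := by
      refine Finset.sum_lt_sum (fun i _ => ?_) ⟨j, Finset.mem_univ j, ?_⟩
      · rcases (hy0 i).eq_or_lt with h | h
        · simp [← h]
        · exact mul_le_mul_of_nonneg_right (hcon i h).le h.le
      · exact mul_lt_mul_of_pos_right (hcon j hj) hj
    rw [← Finset.mul_sum, hy1, mul_one] at hlt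
    exact lt_irrefl _ hlt
  set e : Fin n → ℝ := Pi.single j 1 with he
  have he1 : ∑ i, e i = 1 := by simp [he]
  have heS : e ∈ stdSimplex ℝ (Fin n) := single_mem_stdSimplex ℝ j
  set g := restrictLine f y (y - e) with hg
  have hgrid' : ∀ i, ∃ k : ℕ, (s : ℝ) * (y i + 1 / s * (y - e) i) = k := by
    intro i
    obtain ⟨k, hk⟩ := hgrid i
    have h1 : (s : ℝ) * (y i + 1 / s * (y - e) i) = k - e i := by
      rw [← hk, Pi.sub_apply]
      push_cast
      field_simp
      ring
    rcases eq_or_ne i j with rfl | hij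
    · have hk0 : k ≠ 0 := by
        rintro rfl
        have : 0 < ((s + 1 : ℕ) : ℝ) * y i := by positivity
        rw [hk] at this
        simp at this
      refine ⟨k - 1, ?_⟩
      rw [h1, Nat.cast_sub (by omega)]
      simp [he]
    · exact ⟨k, by rw [h1]; simp [he, hij]⟩
  refine ⟨fun i => y i + 1 / s * (y - e) i, ⟨fun i => ?_, ?_⟩, hgrid', ?_⟩
  · obtain ⟨k, hk⟩ := hgrid' i
    exact nonneg_of_mul_nonneg_right (hk ▸ Nat.cast_nonneg k) hs0
  · simp [Finset.sum_add_distrib, ← Finset.mul_sum, hy1, he1]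
  · have hrange : ∀ u ∈ Set.Icc (-1 : ℝ) 0, g.eval u ∈ Set.Icc A B := by
      intro u hu
      rw [hg, eval_restrictLine]
      refine hAB _ ?_
      have h := convex_stdSimplex ℝ (Fin n) (⟨hy0, hy1⟩ : y ∈ stdSimplex ℝ (Fin n)) heS
        (show 0 ≤ 1 + u by linarith [hu.1]) (show 0 ≤ -u by linarith [hu.2]) (by ring)
      convert h using 1
      ext i
      simp
      ring
    have hrem := taylorRemainder_le (t := 1 / (s : ℝ)) (by positivity)
      ((div_le_one hs0).2 hs1) ((natDegree_restrictLine_le f y (y - e)).trans hf.le) hrange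
    have hcoeff : g.coeff 1 ≤ 0 := by
      rw [hg, hc]
      simp only [Pi.sub_apply, mul_sub, Finset.sum_sub_distrib]
      have : ∑ i, c i * e i = c j := by simp [he, Pi.single_apply]
      linarith
    rw [← hg, taylorRemainder_apply, hg, coeff_zero_restrictLine, eval_restrictLine, ← hg] at hrem
    have h2 : g.coeff 1 / s ≤ 0 := div_nonpos_of_nonpos_of_nonneg hcoeff hs0.le
    rw [div_pow, one_pow, one_div_mul_eq_div, one_div_mul_eq_div] at hrem
    exact sub_le_iff_le_add'.1 ((le_sub_self_iff _).2 h2 |>.trans hrem)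

theorem exists_grid_point_of_grid_add {n d : ℕ} {f : MvPolynomial (Fin n) ℝ}
    (hf : f.totalDegree = d) {A B : ℝ}
    (hAB : ∀ z ∈ stdSimplex ℝ (Fin n), eval z f ∈ Set.Icc A B)
    {r : ℕ} (hr : 1 ≤ r) (k : ℕ) {y : Fin n → ℝ} (hy : y ∈ stdSimplex ℝ (Fin n))
    (hgrid : ∀ i, ∃ l : ℕ, ((r + k : ℕ) : ℝ) * y i = l) :
    ∃ z ∈ stdSimplex ℝ (Fin n), (∀ i, ∃ l : ℕ, (r : ℝ) * z i = l) ∧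
      eval z f ≤ eval y f + k * ((((d - 1) * (d.factorial - 1) * d ^ (2 * d - 1) *
        (2 * d - 1).choose d : ℕ) : ℝ) * (B - A) / (r : ℝ) ^ 2) := by
  induction k generalizing y with
  | zero => exact ⟨y, hy, hgrid, by simp⟩
  | succ k ih =>
    obtain ⟨z, hz, hzgrid, hzf⟩ := exists_grid_point_of_grid_succ hf hAB
      (show 1 ≤ r + k by omega) hy hgrid
    obtain ⟨w, hw, hwgrid, hwf⟩ := ih hz hzgrid
    refine ⟨w, hw, hwgrid, ?_⟩
    have hr0 : (0 : ℝ) < r := by exact_mod_cast hr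
    have hBA : 0 ≤ B - A := by linarith [(hAB y hy).1, (hAB y hy).2]
    have hle : (((d - 1) * (d.factorial - 1) * d ^ (2 * d - 1) *
        (2 * d - 1).choose d : ℕ) : ℝ) * (B - A) / ((r + k : ℕ) : ℝ) ^ 2 ≤
        (((d - 1) * (d.factorial - 1) * d ^ (2 * d - 1) *
        (2 * d - 1).choose d : ℕ) : ℝ) * (B - A) / (r : ℝ) ^ 2 := by
      refine div_le_div_of_nonneg_left (mul_nonneg (Nat.cast_nonneg _) hBA) (by positivity) ?_
      exact pow_le_pow_left₀ hr0.le (by exact_mod_cast Nat.le_add_right r k) 2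
    rw [Nat.cast_succ, add_mul, one_mul]
    linarith

theorem grid_search_degree_d_rational_minimizer (n d : ℕ) (f : MvPolynomial (Fin n) ℝ)
    (hf : f.totalDegree = d) (xstar : Fin n → ℝ)
    (hxs : xstar ∈ stdSimplex ℝ (Fin n))
    (hxsmin : ∀ y ∈ stdSimplex ℝ (Fin n), eval xstar f ≤ eval y f)
    (m : ℕ) (hm : 1 ≤ m) (hdenom : ∀ i, ∃ k : ℕ, (m : ℝ) * xstar i = k)
    (r : ℕ) (hr : 1 ≤ r) (fmax fgrid : ℝ)
    (hmax : IsGreatest ((fun x => eval x f) '' stdSimplex ℝ (Fin n)) fmax)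
    (hgrid : IsLeast ((fun x => eval x f) ''
      {x | x ∈ stdSimplex ℝ (Fin n) ∧ ∀ i, ∃ k : ℕ, (r : ℝ) * x i = k}) fgrid) :
    fgrid - eval xstar f ≤
      ((m : ℝ) * (((d - 1) * (d.factorial - 1) * d ^ (2 * d - 1) *
          (2 * d - 1).choose d : ℕ) : ℝ) / (r : ℝ) ^ 2) * (fmax - eval xstar f) := by
  have hAB : ∀ z ∈ stdSimplex ℝ (Fin n), eval z f ∈ Set.Icc (eval xstar f) fmax :=
    fun z hz => ⟨hxsmin z hz, hmax.2 ⟨z, hz, rfl⟩⟩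
  have hsum : r + (m - r % m) = (r / m + 1) * m := by
    have h1 := Nat.div_add_mod' r m
    have h2 := Nat.mod_lt r (show m > 0 by omega)
    rw [add_mul, one_mul]
    omega
  have hxgrid : ∀ i, ∃ l : ℕ, ((r + (m - r % m) : ℕ) : ℝ) * xstar i = l := by
    intro i
    obtain ⟨k, hk⟩ := hdenom i
    refine ⟨(r / m + 1) * k, ?_⟩
    rw [hsum, Nat.cast_mul, mul_assoc, hk, Nat.cast_mul]
  obtain ⟨z, hz, hzgrid, hzf⟩ := exists_grid_point_of_grid_add hf hAB hr (m - r % m) hxs hxgrid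
  have hgz : fgrid ≤ eval z f := hgrid.2 ⟨z, ⟨hz, hzgrid⟩, rfl⟩
  have hM : 0 ≤ fmax - eval xstar f := sub_nonneg.2 (hmax.2 ⟨xstar, hxs, rfl⟩)
  have hkm : ((m - r % m : ℕ) : ℝ) ≤ m := by exact_mod_cast Nat.sub_le m (r % m)
  calc fgrid - eval xstar f ≤ ((m - r % m : ℕ) : ℝ) * _ := by linarith
    _ ≤ (m : ℝ) * _ := mul_le_mul_of_nonneg_right hkm
        (div_nonneg (mul_nonneg (Nat.cast_nonneg _) hM) (sq_nonneg _))
    _ = _ := by ring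
end

section
/- Let x* ∈ Δ_n with support I = {i ∈ [n] : x*_i > 0}. Then for each integer r ≥ 1, there exists a point x̃ ∈ Δ(n,r) such that ‖x* − x̃‖_∞ ≤ (1/r)·(1 − 1/|I|) and x̃_i = 0 for all i ∈ [n] \ I. -/
theorem Finset.exists_subset_card_eq_forall_le {ι α : Type*} [DecidableEq ι] [LinearOrder α]
    (I : Finset ι) (f : ι → α) (k : ℕ) (hk : k ≤ I.card) :
    ∃ S ⊆ I, S.card = k ∧ ∀ i ∈ S, ∀ j ∈ I \ S, f j ≤ f i := by
  induction k with
  | zero => exact ⟨∅, by simp⟩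
  | succ k ih =>
    obtain ⟨S, hSI, hS, hmax⟩ := ih (by omega)
    have hne : (I \ S).Nonempty := by
      rw [← Finset.card_pos, Finset.card_sdiff_of_subset hSI]
      omega
    obtain ⟨a, ha, hamax⟩ := Finset.exists_max_image (I \ S) f hne
    have ha' := Finset.mem_sdiff.mp ha
    refine ⟨insert a S, Finset.insert_subset ha'.1 hSI, ?_, ?_⟩
    · rw [Finset.card_insert_of_notMem ha'.2, hS]
    · intro i hi j hj
      simp only [Finset.mem_sdiff, Finset.mem_insert, not_or] at hj
      have hjS : j ∈ I \ S := Finset.mem_sdiff.mpr ⟨hj.1, hj.2.2⟩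
      rcases Finset.mem_insert.mp hi with rfl | hi
      · exact hamax j hjS
      · exact hmax i hi j hjS

/-- Numbers in `[0, 1]` with an integer sum can be rounded to `0` or `1` preserving the sum, with
error at most `1 - 1 / m`, where `m` is how many of them there are. -/
theorem Finset.exists_rounding_of_sum_eq_natCast {ι : Type*} [DecidableEq ι] (I : Finset ι)
    (f : ι → ℝ) (k : ℕ) (h0 : ∀ i ∈ I, 0 ≤ f i) (h1 : ∀ i ∈ I, f i ≤ 1)
    (hsum : ∑ i ∈ I, f i = k) :
    ∃ S ⊆ I, S.card = k ∧ (∀ i ∈ S, 1 / (I.card : ℝ) ≤ f i) ∧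
      ∀ i ∈ I \ S, f i ≤ 1 - 1 / (I.card : ℝ) := by
  have hk : k ≤ I.card := by
    have h := Finset.sum_le_card_nsmul I f 1 h1
    rw [hsum, nsmul_one] at h
    exact_mod_cast h
  obtain ⟨S, hSI, hS, hmax⟩ := I.exists_subset_card_eq_forall_le f k hk
  refine ⟨S, hSI, hS, fun i hi => ?_, fun j hj => ?_⟩
  · have hIpos : (0 : ℝ) < I.card := by exact_mod_cast Finset.card_pos.mpr ⟨i, hSI hi⟩
    rw [div_le_iff₀ hIpos]
    have hupper : ∑ j ∈ S.erase i, f j ≤ (k : ℝ) - 1 := by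
      have h := Finset.sum_le_card_nsmul (S.erase i) f 1
        fun j hj => h1 j (hSI (Finset.mem_of_mem_erase hj))
      rw [nsmul_one, Finset.cast_card_erase_of_mem hi, hS] at h
      exact h
    have hlower : ∑ j ∈ I \ S, f j ≤ (I.card - k : ℝ) * f i := by
      have h := Finset.sum_le_card_nsmul (I \ S) f (f i) (hmax i hi)
      rwa [nsmul_eq_mul, Finset.card_sdiff_of_subset hSI, hS, Nat.cast_sub hk] at h
    have hsplit := Finset.sum_sdiff (f := f) hSI
    have herase := Finset.add_sum_erase S f hi
    have hk1 : (1 : ℝ) ≤ k := by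
      rw [← hS]
      exact_mod_cast Finset.card_pos.mpr ⟨i, hi⟩
    nlinarith [h0 i (hSI hi)]
  · have hj' := Finset.mem_sdiff.mp hj
    have hins : insert j S ⊆ I := Finset.insert_subset hj'.1 hSI
    have hcard : (k : ℝ) + 1 ≤ I.card := by
      have h := Finset.card_le_card hins
      rw [Finset.card_insert_of_notMem hj'.2, hS] at h
      exact_mod_cast h
    have hle : ∑ i ∈ insert j S, f i ≤ k :=
      hsum ▸ Finset.sum_le_sum_of_subset_of_nonneg hins fun i hi _ => h0 i hi
    have hge : (k : ℝ) * f j ≤ ∑ i ∈ S, f i := by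
      have h := Finset.card_nsmul_le_sum S f (f j) fun i hi => hmax i hi j hj
      rwa [nsmul_eq_mul, hS] at h
    rw [Finset.sum_insert hj'.2] at hle
    have hk0 : (0 : ℝ) < k + 1 := by positivity
    have hfj : f j ≤ 1 - 1 / ((k : ℝ) + 1) := by
      rw [one_sub_div hk0.ne', le_div_iff₀ hk0]
      linarith
    have := one_div_le_one_div_of_le hk0 hcard
    linarith

theorem grid_point_close_to_simplex_point (n : ℕ) (xstar : Fin n → ℝ)
    (hxs : xstar ∈ stdSimplex ℝ (Fin n)) (r : ℕ) (hr : 1 ≤ r) :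
    ∃ xt : Fin n → ℝ,
      (xt ∈ stdSimplex ℝ (Fin n) ∧ ∀ i, ∃ k : ℕ, (r : ℝ) * xt i = k) ∧
      ‖xstar - xt‖ ≤ (1 / r) *
        (1 - 1 / ((Finset.univ.filter fun i => 0 < xstar i).card : ℝ)) ∧
      ∀ i, xstar i = 0 → xt i = 0 := by
  obtain ⟨hx0, hx1⟩ := hxs
  have hr0 : (0 : ℝ) < r := by exact_mod_cast hr
  set I := Finset.univ.filter fun i => 0 < xstar i with hI
  have hnotI : ∀ i, i ∉ I → xstar i = 0 := fun i hi =>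
    le_antisymm (by simpa [hI] using hi) (hx0 i)
  have hIpos : 0 < I.card := by
    rw [Finset.card_pos, Finset.nonempty_iff_ne_empty]
    intro h
    have hzero : ∑ i, xstar i = 0 := Finset.sum_eq_zero fun i _ => hnotI i (by simp [h])
    linarith
  have hbound : (0 : ℝ) ≤ 1 - 1 / (I.card : ℝ) := by
    rw [sub_nonneg, div_le_one (by exact_mod_cast hIpos)]
    exact_mod_cast hIpos
  let g : Fin n → ℕ := fun i => ⌊(r : ℝ) * xstar i⌋₊
  have hg : ∀ i, (g i : ℝ) ≤ r * xstar i := fun i =>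
    Nat.floor_le (mul_nonneg hr0.le (hx0 i))
  have hg' : ∀ i, r * xstar i < g i + 1 := fun i => Nat.lt_floor_add_one _
  have hrsum : ∑ i, (r : ℝ) * xstar i = r := by rw [← Finset.mul_sum, hx1, mul_one]
  have hgr : ∑ i, g i ≤ r := by
    have h : ∑ i, (g i : ℝ) ≤ r := hrsum ▸ Finset.sum_le_sum fun i _ => hg i
    exact_mod_cast h
  have hg0 : ∀ i, i ∉ I → g i = 0 := fun i hi => by simp [g, hnotI i hi]
  have hfrac : ∑ i ∈ I, ((r : ℝ) * xstar i - g i) = (r - ∑ i, g i : ℕ) := by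
    rw [Finset.sum_subset (Finset.subset_univ I)
      fun i _ hi => by simp [hg0 i hi, hnotI i hi], Finset.sum_sub_distrib, hrsum,
      Nat.cast_sub hgr, Nat.cast_sum]
  obtain ⟨S, hSI, hS, hup, hdown⟩ := I.exists_rounding_of_sum_eq_natCast
    (fun i => (r : ℝ) * xstar i - g i) _ (fun i _ => sub_nonneg.mpr (hg i))
    (fun i _ => by linarith [hg' i]) hfrac
  let a : Fin n → ℕ := fun i => g i + if i ∈ S then 1 else 0
  have ha : ∑ i, a i = r := by
    simp only [a, Finset.sum_add_distrib, Finset.sum_ite_mem, Finset.univ_inter,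
      Finset.sum_const, smul_eq_mul, mul_one, hS]
    omega
  have ha0 : ∀ i, i ∉ I → a i = 0 := fun i hi => by
    simp [a, hg0 i hi, Finset.notMem_mono hSI hi]
  refine ⟨fun i => a i / r, ⟨⟨fun i => by positivity, ?_⟩, fun i => ⟨a i, ?_⟩⟩, ?_, ?_⟩
  · rw [← Finset.sum_div, ← Nat.cast_sum, ha, div_self hr0.ne']
  · exact mul_div_cancel₀ _ hr0.ne'
  · refine (pi_norm_le_iff_of_nonneg (by positivity)).mpr fun i => ?_
    have hscale : xstar i - a i / r = 1 / r * (r * xstar i - a i) := by field_simp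
    rw [Pi.sub_apply, hscale, norm_mul, Real.norm_of_nonneg (by positivity)]
    refine mul_le_mul_of_nonneg_left ?_ (by positivity)
    rw [Real.norm_eq_abs, abs_le]
    by_cases hiS : i ∈ S
    · have hai : (a i : ℝ) = g i + 1 := by simp [a, hiS]
      have := hup i hiS
      rw [hai]
      constructor <;> linarith [hg' i]
    · have hai : (a i : ℝ) = g i := by simp [a, hiS]
      rw [hai]
      refine ⟨by linarith [hg i], ?_⟩
      by_cases hiI : i ∈ I
      · exact hdown i (Finset.mem_sdiff.mpr ⟨hiI, hiS⟩)
      · simpa [hnotI i hiI, hg0 i hiI] using hbound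
  · intro i hi
    have : i ∉ I := by simp [hI, hi]
    simp [ha0 i this]
end

section
/- Let f be a homogeneous polynomial of degree d ≥ 1 in n variables all of whose coefficients are nonnegative. Let x* be a global minimizer of f over Δ_n, let r ≥ 1 be an integer, and let x̃ ∈ Δ(n,r) be a point satisfying ‖x* − x̃‖_∞ ≤ (1/r)(1 − 1/|I|) and x̃_i = 0 for all i outside the support I of x*. Suppose s > 0 is a scalar such that |x̃_i − x*_i| ≤ s·x*_i for all i ∈ [n]. Then f_{min,Δ(n,r)} − f_{min,Δ_n} ≤ ((1+s)^d − (1+ds))·f_{min,Δ_n}. -/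
open MvPolynomial

/-- The Taylor remainder of order two of `t ↦ ∏ i, (1 + t i) ^ α i` at `0` is dominated by that of
`s ↦ (1 + s) ^ |α|` whenever `|t i| ≤ s`. -/
theorem abs_prod_one_add_pow_sub_le {σ : Type*} (t : σ → ℝ) (s : ℝ) (ht : ∀ i, |t i| ≤ s)
    (α : σ →₀ ℕ) :
    |(α.prod fun i k => (1 + t i) ^ k) - 1| ≤ (1 + s) ^ α.degree - 1 ∧
    |(α.prod fun i k => (1 + t i) ^ k) - 1 - α.sum fun i k => (k : ℝ) * t i| ≤
      (1 + s) ^ α.degree - (1 + α.degree * s) := by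
  classical
  have add_step : ∀ P Q A B L M a b : ℝ, |P - 1| ≤ A - 1 → |P - 1 - L| ≤ A - (1 + a) →
      |Q - 1| ≤ B - 1 → |Q - 1 - M| ≤ B - (1 + b) →
      |P * Q - 1| ≤ A * B - 1 ∧ |P * Q - 1 - (L + M)| ≤ A * B - (1 + (a + b)) := by
    intro P Q A B L M a b hP hPL hQ hQM
    have hPQ : |(P - 1) * (Q - 1)| ≤ (A - 1) * (B - 1) := by
      rw [abs_mul]
      exact mul_le_mul hP hQ (abs_nonneg _) ((abs_nonneg _).trans hP)
    simp only [abs_le] at *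
    constructor <;> constructor <;> linarith [hPQ.1, hPQ.2]
  induction α using Finsupp.induction_linear with
  | zero => simp
  | add β γ hβ hγ =>
    rw [Finsupp.prod_add_index' (by simp) (by intros; rw [pow_add]),
      Finsupp.sum_add_index' (by simp) (by intros; push_cast; ring), map_add, pow_add,
      Nat.cast_add, add_mul]
    exact add_step _ _ _ _ _ _ _ _ hβ.1 hβ.2 hγ.1 hγ.2
  | single i k =>
    rw [Finsupp.prod_single_index (by simp), Finsupp.sum_single_index (by simp),
      Finsupp.degree_single]
    induction k with
    | zero => simp
    | succ k ih =>
      rw [pow_succ, pow_succ, Nat.cast_succ, add_mul, add_mul, one_mul, one_mul]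
      exact add_step _ _ _ _ _ _ _ _ ih.1 ih.2 (by simpa using ht i) (by simp)

theorem hasDerivAt_prod_one_add_mul_pow {σ : Type*} (t : σ → ℝ) (α : σ →₀ ℕ) :
    HasDerivAt (fun u : ℝ => α.prod fun i k => (1 + u * t i) ^ k)
      (α.sum fun i k => (k : ℝ) * t i) 0 := by
  classical
  induction α using Finsupp.induction_linear with
  | zero => simpa using hasDerivAt_const (0 : ℝ) (1 : ℝ)
  | add β γ hβ hγ =>
    rw [Finsupp.sum_add_index' (by simp) (by intros; push_cast; ring)]
    have hmul := hβ.mul hγ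
    simp only [zero_mul, add_zero, one_pow, Finsupp.prod, Finset.prod_const_one, mul_one,
      one_mul] at hmul
    refine hmul.congr_of_eventuallyEq (Filter.Eventually.of_forall fun u => ?_)
    exact Finsupp.prod_add_index' (by simp) (by intros; rw [pow_add])
  | single i k =>
    rw [Finsupp.sum_single_index (by simp)]
    simp only [Finsupp.prod_single_index, pow_zero]
    simpa using ((((hasDerivAt_id (0 : ℝ)).mul_const (t i)).const_add 1).fun_pow k)

/-- Evaluation of a polynomial at a coordinatewise product of points. -/
theorem MvPolynomial.eval_mul_eq_sum {σ R : Type*} [CommSemiring R] (f : MvPolynomial σ R)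
    (x y : σ → R) :
    eval (fun i => x i * y i) f =
      ∑ α ∈ f.support, (coeff α f * α.prod fun i k => x i ^ k) * α.prod fun i k => y i ^ k := by
  rw [eval_eq]
  refine Finset.sum_congr rfl fun α _ => ?_
  simp only [mul_pow, Finset.prod_mul_distrib, Finsupp.prod, mul_assoc]

theorem grid_search_nonneg_homogeneous (n d : ℕ) (hd : 1 ≤ d)
    (f : MvPolynomial (Fin n) ℝ) (hf : f.IsHomogeneous d)
    (hcoeff : ∀ α : Fin n →₀ ℕ, 0 ≤ coeff α f)
    (xstar : Fin n → ℝ) (hxs : xstar ∈ stdSimplex ℝ (Fin n))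
    (hxsmin : ∀ y ∈ stdSimplex ℝ (Fin n), eval xstar f ≤ eval y f)
    (r : ℕ) (hr : 1 ≤ r) (xt : Fin n → ℝ)
    (hxt : xt ∈ stdSimplex ℝ (Fin n) ∧ ∀ i, ∃ l : ℕ, (r : ℝ) * xt i = l)
    (hclose : ‖xstar - xt‖ ≤ (1 / r) *
      (1 - 1 / ((Finset.univ.filter fun i => 0 < xstar i).card : ℝ)))
    (hzero : ∀ i, xstar i = 0 → xt i = 0)
    (s : ℝ) (hs : 0 < s) (hsx : ∀ i, |xt i - xstar i| ≤ s * xstar i)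
    (fgrid : ℝ)
    (hgrid : IsLeast ((fun x => eval x f) ''
      {x | x ∈ stdSimplex ℝ (Fin n) ∧ ∀ i, ∃ l : ℕ, (r : ℝ) * x i = l}) fgrid) :
    fgrid - eval xstar f ≤
      ((1 + s) ^ d - (1 + d * s)) * eval xstar f := by
  have hle : fgrid ≤ eval xt f := hgrid.2 ⟨xt, hxt, rfl⟩
  set t : Fin n → ℝ := fun i => (xt i - xstar i) / xstar i with ht_def
  have hxt_t : ∀ i, xstar i * t i = xt i - xstar i := by
    intro i
    by_cases h : xstar i = 0
    · simp [h, hzero i h]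
    · exact mul_div_cancel₀ _ h
  have ht : ∀ i, |t i| ≤ s := by
    intro i
    rw [ht_def, abs_div, abs_of_nonneg (hxs.1 i)]
    exact div_le_of_le_mul₀ (hxs.1 i) hs.le (hsx i)
  set w : (Fin n →₀ ℕ) → ℝ := fun α => coeff α f * α.prod fun i k => xstar i ^ k
  have hw : ∀ α, 0 ≤ w α := fun α =>
    mul_nonneg (hcoeff α) (Finset.prod_nonneg fun i _ => pow_nonneg (hxs.1 i) _)
  have heval : ∀ u : ℝ, eval (fun i => xstar i * (1 + u * t i)) f =
      ∑ α ∈ f.support, w α * α.prod fun i k => (1 + u * t i) ^ k := fun u =>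
    f.eval_mul_eq_sum xstar _
  have heval_star : eval xstar f = ∑ α ∈ f.support, w α := eval_eq _ _
  have heval_xt : eval xt f = ∑ α ∈ f.support, w α * α.prod fun i k => (1 + t i) ^ k := by
    have h := heval 1
    simp only [one_mul, mul_add, mul_one, hxt_t, add_sub_cancel] at h
    exact h
  have hderiv : HasDerivAt (fun u : ℝ => eval (fun i => xstar i * (1 + u * t i)) f)
      (∑ α ∈ f.support, w α * α.sum fun i k => (k : ℝ) * t i) 0 := by
    simp only [heval]
    exact HasDerivAt.fun_sum fun α _ => (hasDerivAt_prod_one_add_mul_pow t α).const_mul _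
  have hmin : IsLocalMin (fun u : ℝ => eval (fun i => xstar i * (1 + u * t i)) f) 0 := by
    filter_upwards [Metric.ball_mem_nhds (0 : ℝ) (inv_pos.2 hs)] with u hu
    simp only [zero_mul, add_zero, mul_one]
    rw [mem_ball_zero_iff, Real.norm_eq_abs] at hu
    refine hxsmin _ ⟨fun i => mul_nonneg (hxs.1 i) ?_, ?_⟩
    · have h : |u * t i| ≤ 1 := by
        rw [abs_mul, ← inv_mul_cancel₀ hs.ne']
        exact mul_le_mul hu.le (ht i) (abs_nonneg _) (inv_pos.2 hs).le
      linarith [(abs_le.1 h).1]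
    · simp only [mul_add, mul_one, mul_left_comm _ u, hxt_t, Finset.sum_add_distrib,
        ← Finset.mul_sum, Finset.sum_sub_distrib, hxs.2, hxt.1.2, sub_self, mul_zero, add_zero]
  have hcrit := hmin.hasDerivAt_eq_zero hderiv
  calc fgrid - eval xstar f ≤ eval xt f - eval xstar f := sub_le_sub_right hle _
    _ = ∑ α ∈ f.support, w α *
        ((α.prod fun i k => (1 + t i) ^ k) - 1 - α.sum fun i k => (k : ℝ) * t i) := by
      simp only [mul_sub, mul_one, Finset.sum_sub_distrib, hcrit, sub_zero, heval_xt, heval_star]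
    _ ≤ ∑ α ∈ f.support, w α * ((1 + s) ^ d - (1 + d * s)) := by
      refine Finset.sum_le_sum fun α hα => mul_le_mul_of_nonneg_left ?_ (hw α)
      have hdeg : α.degree = d := by
        rw [Finsupp.degree_eq_weight_one]
        exact hf (mem_support_iff.1 hα)
      have h := (abs_prod_one_add_pow_sub_le t s ht α).2
      rw [hdeg] at h
      exact (le_abs_self _).trans h
    _ = ((1 + s) ^ d - (1 + d * s)) * eval xstar f := by
      rw [← Finset.sum_mul, ← heval_star, mul_comm]
end

section
/- Let f be a polynomial of degree d ≥ 1 in n variables, let x* be a global minimizer of f over Δ_n, and let x*_min be the smallest positive component of x*. Then for any 0 < ε ≤ 2/3 and any integer r ≥ d/(ε·x*_min), one has f_{min,Δ(n,r)} − f_{min,Δ_n} ≤ (1/r²)·((1+ε)·d^d·C(d,2)/(x*_min)²)·C(2d−1,d)·(f_{max,Δ_n} − f_{min,Δ_n}). -/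
open MvPolynomial

/-- The value at `x` of the homogeneous form of degree `d` with coefficient tensor `B`. -/
def tensorForm {n d : ℕ} (B : (Fin d → Fin n) → ℝ) (x : Fin n → ℝ) : ℝ :=
  ∑ w, B w * ∏ j, x (w j)

lemma tensorForm_smul {n d : ℕ} (B : (Fin d → Fin n) → ℝ) (c : ℝ) (x : Fin n → ℝ) :
    tensorForm B (c • x) = c ^ d * tensorForm B x := by
  unfold tensorForm
  rw [Finset.mul_sum]
  refine Finset.sum_congr rfl fun w _ => ?_
  simp only [Pi.smul_apply, smul_eq_mul, Finset.prod_mul_distrib, Finset.prod_const,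
    Finset.card_univ, Fintype.card_fin]
  ring

lemma exists_tensorForm_const_mul {n d : ℕ} (c : ℝ) (B : (Fin d → Fin n) → ℝ) :
    ∃ B' : (Fin d → Fin n) → ℝ, ∀ x, tensorForm B' x = c * tensorForm B x :=
  ⟨fun w => c * B w, fun x => by simp [tensorForm, Finset.mul_sum, mul_assoc]⟩

lemma exists_tensorForm_coord_mul {n d : ℕ} (i : Fin n) (B : (Fin d → Fin n) → ℝ) :
    ∃ B' : (Fin (d + 1) → Fin n) → ℝ, ∀ x, tensorForm B' x = x i * tensorForm B x := by
  refine ⟨fun w => if w 0 = i then B (Fin.tail w) else 0, fun x => ?_⟩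
  unfold tensorForm
  rw [← (Fin.consEquiv fun _ => Fin n).sum_comp, Fintype.sum_prod_type,
    Finset.sum_eq_single i]
  · simp [Fin.consEquiv, Fin.prod_univ_succ, Finset.mul_sum, mul_left_comm]
  · intro j _ hj
    simp [Fin.consEquiv, hj]
  · simp

lemma exists_tensorForm_sum {n d : ℕ} {ι : Type*} (s : Finset ι)
    (B : ι → (Fin d → Fin n) → ℝ) :
    ∃ B' : (Fin d → Fin n) → ℝ, ∀ x, tensorForm B' x = ∑ i ∈ s, tensorForm (B i) x := by
  refine ⟨fun w => ∑ i ∈ s, B i w, fun x => ?_⟩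
  simp only [tensorForm, Finset.sum_mul]
  exact Finset.sum_comm

lemma exists_tensorForm_monomial {n : ℕ} (d : ℕ) (m : Fin n →₀ ℕ) (hm : m.degree ≤ d) :
    ∃ B : (Fin d → Fin n) → ℝ, ∀ x : Fin n → ℝ, ∑ i, x i = 1 →
      tensorForm B x = ∏ i, x i ^ m i := by
  induction d generalizing m with
  | zero =>
    have h0 : m = 0 := (Finsupp.degree_eq_zero_iff m).mp (Nat.le_zero.mp hm)
    subst h0
    exact ⟨fun _ => 1, fun x _ => by simp [tensorForm]⟩
  | succ d ih =>
    by_cases h0 : m = 0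
    · obtain ⟨B, hB⟩ := ih m (by simp [h0])
      choose B' hB' using fun i => exists_tensorForm_coord_mul i B
      obtain ⟨B'', hB''⟩ := exists_tensorForm_sum Finset.univ B'
      refine ⟨B'', fun x hx => ?_⟩
      simp only [hB'', hB', hB x hx, ← Finset.sum_mul, hx, one_mul]
    · obtain ⟨i, hi⟩ := Finsupp.ne_iff.mp h0
      have hle : Finsupp.single i 1 ≤ m := by
        rw [Finsupp.single_le_iff]
        exact Nat.one_le_iff_ne_zero.mpr hi
      obtain ⟨m', rfl⟩ := exists_add_of_le hle
      obtain ⟨B, hB⟩ := ih m' (by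
        rw [map_add, Finsupp.degree_single] at hm
        omega)
      obtain ⟨B', hB'⟩ := exists_tensorForm_coord_mul i B
      refine ⟨B', fun x hx => ?_⟩
      rw [hB', hB x hx]
      simp only [Finsupp.add_apply, pow_add, Finset.prod_mul_distrib]
      congr 1
      rw [Finset.prod_eq_single i]
      · simp
      · intro j _ hj
        simp [hj.symm]
      · simp

lemma exists_tensorForm_eval {n d : ℕ} (f : MvPolynomial (Fin n) ℝ) (hf : f.totalDegree ≤ d) :
    ∃ B : (Fin d → Fin n) → ℝ, ∀ x : Fin n → ℝ, ∑ i, x i = 1 → tensorForm B x = eval x f := by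
  have key : ∀ m : Fin n →₀ ℕ, ∃ B : (Fin d → Fin n) → ℝ, m ∈ f.support →
      ∀ x : Fin n → ℝ, ∑ i, x i = 1 → tensorForm B x = coeff m f * ∏ i, x i ^ m i := by
    intro m
    by_cases hm : m ∈ f.support
    · obtain ⟨B, hB⟩ := exists_tensorForm_monomial d m ((le_totalDegree hm).trans hf)
      obtain ⟨B', hB'⟩ := exists_tensorForm_const_mul (coeff m f) B
      exact ⟨B', fun _ x hx => by rw [hB', hB x hx]⟩
    · exact ⟨0, fun h => absurd h hm⟩
  choose B hB using key
  obtain ⟨B', hB'⟩ := exists_tensorForm_sum f.support B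
  refine ⟨B', fun x hx => ?_⟩
  rw [hB', eval_eq']
  exact Finset.sum_congr rfl fun m hm => hB m hm x hx

/-- Averaging a coefficient tensor over permutations of the positions. -/
noncomputable def symmTensor {n d : ℕ} (B : (Fin d → Fin n) → ℝ) (w : Fin d → Fin n) : ℝ :=
  (∑ σ : Equiv.Perm (Fin d), B (w ∘ σ)) / d.factorial

lemma tensorForm_symmTensor {n d : ℕ} (B : (Fin d → Fin n) → ℝ) (x : Fin n → ℝ) :
    tensorForm (symmTensor B) x = tensorForm B x := by
  have hperm : ∀ σ : Equiv.Perm (Fin d),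
      ∑ w : Fin d → Fin n, B (w ∘ σ) * ∏ j, x (w j) = tensorForm B x := by
    intro σ
    unfold tensorForm
    rw [← (Equiv.arrowCongr σ (Equiv.refl (Fin n))).sum_comp]
    refine Finset.sum_congr rfl fun w _ => ?_
    congr 1
    · congr 1
      ext j
      simp
    · simpa using Equiv.prod_comp σ.symm fun j => x (w j)
  have hd : (d.factorial : ℝ) ≠ 0 := by positivity
  have : tensorForm (symmTensor B) x =
      (∑ σ : Equiv.Perm (Fin d), ∑ w : Fin d → Fin n, B (w ∘ σ) * ∏ j, x (w j)) /
        d.factorial := by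
    rw [Finset.sum_comm, Finset.sum_div]
    refine Finset.sum_congr rfl fun w _ => ?_
    rw [symmTensor, ← Finset.sum_mul]
    ring
  rw [this, Finset.sum_congr rfl fun σ _ => hperm σ]
  simp [Fintype.card_perm, mul_div_cancel_left₀ _ hd]

lemma sum_perm_eq_alternating_sum {α : Type*} [Fintype α] [DecidableEq α] (G : (α → α) → ℝ) :
    ∑ σ : Equiv.Perm α, G σ =
      ∑ S : Finset α, (-1) ^ S.card * ∑ φ ∈ Fintype.piFinset fun _ : α => Sᶜ, G φ := by
  have hinner : ∀ φ : α → α,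
      ∑ S : Finset α, (if ∀ j, φ j ∈ Sᶜ then (-1 : ℝ) ^ S.card else 0) =
        if Function.Bijective φ then 1 else 0 := by
    intro φ
    have h1 : (Finset.univ.filter fun S : Finset α => ∀ j, φ j ∈ Sᶜ) =
        ((Finset.univ.image φ)ᶜ).powerset := by
      ext S
      simp only [Finset.mem_filter, Finset.mem_univ, true_and, Finset.mem_compl,
        Finset.mem_powerset, Finset.subset_iff, Finset.mem_image, not_exists]
      exact ⟨fun h a ha j hj => h j (hj ▸ ha), fun h j hj => h hj j rfl⟩
    rw [← Finset.sum_filter, h1]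
    have h2 := congrArg (Int.cast : ℤ → ℝ)
      (Finset.sum_powerset_neg_one_pow_card (x := (Finset.univ.image φ)ᶜ))
    push_cast at h2
    rw [h2]
    refine if_congr ?_ rfl rfl
    rw [Finset.compl_eq_empty_iff, ← Finite.surjective_iff_bijective]
    simp [Finset.eq_univ_iff_forall, Function.Surjective]
  calc ∑ σ : Equiv.Perm α, G σ
      = ∑ φ : α → α, (if Function.Bijective φ then 1 else 0) * G φ := by
        simp only [ite_mul, one_mul, zero_mul]
        rw [← Finset.sum_filter]
        refine Finset.sum_bij (fun σ _ => (σ : α → α)) ?_ ?_ ?_ ?_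
        · intro σ _
          simp
        · intro σ _ τ _ h
          exact DFunLike.coe_injective h
        · intro φ hφ
          exact ⟨Equiv.ofBijective φ (Finset.mem_filter.mp hφ).2, Finset.mem_univ _, rfl⟩
        · intros
          rfl
    _ = ∑ φ : α → α, ∑ S : Finset α,
          (if ∀ j, φ j ∈ Sᶜ then (-1 : ℝ) ^ S.card else 0) * G φ := by
        simp only [← hinner, Finset.sum_mul]
    _ = _ := by
        rw [Finset.sum_comm]
        refine Finset.sum_congr rfl fun S _ => ?_
        rw [Finset.mul_sum]
        simp only [ite_mul, zero_mul]
        rw [← Finset.sum_filter]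
        refine Finset.sum_congr ?_ fun _ _ => rfl
        ext φ
        simp

lemma tensorForm_sum_single {n d : ℕ} (B : (Fin d → Fin n) → ℝ) (w : Fin d → Fin n)
    (S : Finset (Fin d)) :
    tensorForm B (∑ i ∈ S, Pi.single (w i) 1) =
      ∑ φ ∈ Fintype.piFinset fun _ : Fin d => S, B (w ∘ φ) := by
  have h : ∀ u : Fin d → Fin n, ∏ j, (∑ i ∈ S, (Pi.single (w i) 1 : Fin n → ℝ)) (u j) =
      ∑ φ ∈ Fintype.piFinset fun _ : Fin d => S, if u = w ∘ φ then 1 else 0 := by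
    intro u
    simp only [Finset.sum_apply, Finset.prod_univ_sum]
    refine Finset.sum_congr rfl fun φ _ => ?_
    simp only [Pi.single_apply, Finset.prod_ite_zero, Finset.prod_const_one]
    refine if_congr ?_ rfl rfl
    simp [funext_iff]
  unfold tensorForm
  simp only [h, Finset.mul_sum]
  rw [Finset.sum_comm]
  refine Finset.sum_congr rfl fun φ _ => ?_
  simp

lemma abs_tensorForm_le {n d : ℕ} (hd : d ≠ 0) (B : (Fin d → Fin n) → ℝ) {M : ℝ}
    (hM : ∀ x ∈ stdSimplex ℝ (Fin n), |tensorForm B x| ≤ M)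
    (x : Fin n → ℝ) (hx : ∀ i, 0 ≤ x i) :
    |tensorForm B x| ≤ M * (∑ i, x i) ^ d := by
  rcases (Finset.sum_nonneg fun i _ => hx i).eq_or_lt with h | h
  · have hx0 : x = (0 : ℝ) • x := by
      ext i
      have := (Finset.sum_eq_zero_iff_of_nonneg fun i _ => hx i).mp h.symm i (Finset.mem_univ i)
      simp [this]
    rw [hx0, tensorForm_smul]
    simp [hd]
  · set s := ∑ i, x i with hs
    have hmem : s⁻¹ • x ∈ stdSimplex ℝ (Fin n) := by
      refine ⟨fun i => mul_nonneg (inv_nonneg.mpr h.le) (hx i), ?_⟩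
      simp only [Pi.smul_apply, smul_eq_mul]
      rw [← Finset.mul_sum, ← hs, inv_mul_cancel₀ h.ne']
    have hxe : x = s • s⁻¹ • x := by rw [smul_inv_smul₀ h.ne']
    rw [hxe, tensorForm_smul, abs_mul, abs_of_pos (pow_pos h d), mul_comm]
    exact mul_le_mul_of_nonneg_right (hM _ hmem) (pow_pos h d).le

lemma two_pow_sub_one_le_factorial_mul_choose {d : ℕ} (hd : d ≠ 0) :
    (2 : ℝ) ^ d - 1 ≤ d.factorial * ((2 * d - 1).choose d : ℝ) := by
  have h1 : d.factorial * (2 * d - 1).choose d = d.ascFactorial d := by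
    rw [Nat.ascFactorial_eq_factorial_mul_choose']
    congr 2
    omega
  have h2 : 2 ^ d ≤ d.ascFactorial d + 1 := by
    rcases Nat.lt_or_ge d 2 with h | h
    · obtain rfl : d = 1 := by omega
      decide
    · exact ((Nat.pow_le_pow_left h d).trans (Nat.pow_succ_le_ascFactorial d d)).trans
        (Nat.le_succ _)
  rw [← h1] at h2
  have h3 : (2 : ℝ) ^ d ≤ d.factorial * ((2 * d - 1).choose d : ℝ) + 1 := by exact_mod_cast h2
  linarith

lemma abs_symmTensor_le {n d : ℕ} (hd : d ≠ 0) (B : (Fin d → Fin n) → ℝ) {M : ℝ} (hM0 : 0 ≤ M)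
    (hM : ∀ x ∈ stdSimplex ℝ (Fin n), |tensorForm B x| ≤ M) (w : Fin d → Fin n) :
    |symmTensor B w| ≤ (d : ℝ) ^ d * ((2 * d - 1).choose d : ℝ) * M := by
  have hfac : (0 : ℝ) < d.factorial := by positivity
  rw [symmTensor, abs_div, abs_of_pos hfac, div_le_iff₀ hfac]
  have hpol := sum_perm_eq_alternating_sum fun φ : Fin d → Fin d => B (w ∘ φ)
  rw [hpol]
  simp only [← tensorForm_sum_single]
  have hterm : ∀ S : Finset (Fin d),
      |(-1) ^ S.card * tensorForm B (∑ i ∈ Sᶜ, Pi.single (w i) 1)| ≤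
        if S = Finset.univ then 0 else M * (d : ℝ) ^ d := by
    intro S
    rw [abs_mul, abs_pow, abs_neg, abs_one, one_pow, one_mul]
    have hb := abs_tensorForm_le hd B hM (∑ i ∈ Sᶜ, Pi.single (w i) 1) (fun k => by
      rw [Finset.sum_apply]
      refine Finset.sum_nonneg fun i _ => ?_
      rw [Pi.single_apply]
      split_ifs <;> norm_num)
    have hs : ∑ k, (∑ i ∈ Sᶜ, (Pi.single (w i) 1 : Fin n → ℝ)) k = (Sᶜ.card : ℝ) := by
      simp only [Finset.sum_apply]
      rw [Finset.sum_comm]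
      simp
    rw [hs] at hb
    refine hb.trans ?_
    split_ifs with hS
    · simp [hS, hd]
    · have : (Sᶜ.card : ℝ) ≤ d := by
        exact_mod_cast (Finset.card_le_univ Sᶜ).trans_eq (Fintype.card_fin d)
      gcongr
  have hcount : ∑ S : Finset (Fin d), (if S = Finset.univ then 0 else M * (d : ℝ) ^ d) =
      ((2 : ℝ) ^ d - 1) * (M * (d : ℝ) ^ d) := by
    have : ∀ S : Finset (Fin d), (if S = Finset.univ then 0 else M * (d : ℝ) ^ d) =
        M * (d : ℝ) ^ d - if S = Finset.univ then M * (d : ℝ) ^ d else 0 := by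
      intro S
      split_ifs <;> simp
    simp only [this, Finset.sum_sub_distrib, Finset.sum_ite_eq', Finset.mem_univ, if_true,
      Finset.sum_const, Finset.card_univ, Fintype.card_finset, Fintype.card_fin, nsmul_eq_mul]
    push_cast
    ring
  calc _ ≤ ∑ S : Finset (Fin d), |(-1) ^ S.card * tensorForm B (∑ i ∈ Sᶜ, Pi.single (w i) 1)| :=
        Finset.abs_sum_le_sum_abs _ _
    _ ≤ _ := Finset.sum_le_sum fun S _ => hterm S
    _ = ((2 : ℝ) ^ d - 1) * (M * (d : ℝ) ^ d) := hcount
    _ ≤ (d.factorial * ((2 * d - 1).choose d : ℝ)) * (M * (d : ℝ) ^ d) := by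
        have := two_pow_sub_one_le_factorial_mul_choose hd
        gcongr
    _ = _ := by ring

lemma abs_prod_one_add_sub_one_sub_sum_le {ι : Type*} (s : Finset ι) (a : ι → ℝ) {t ε : ℝ}
    (ht : 0 ≤ t) (ha : ∀ i ∈ s, |a i| ≤ t) (hst : (s.card : ℝ) * t ≤ ε) (hε : ε ≤ 2 / 3) :
    |∏ i ∈ s, (1 + a i) - 1 - ∑ i ∈ s, a i| ≤ (1 + ε) * (s.card.choose 2 : ℝ) * t ^ 2 := by
  classical
  induction s using Finset.induction_on with
  | empty => simp
  | insert i s hi ih =>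
    rw [Finset.card_insert_of_notMem hi] at hst ⊢
    push_cast at hst
    have hst' : (s.card : ℝ) * t ≤ ε := by linarith
    have hIH := ih (fun j hj => ha j (Finset.mem_insert_of_mem hj)) hst'
    have hai := ha i (Finset.mem_insert_self i s)
    have hsum : |∑ j ∈ s, a j| ≤ s.card * t := by
      refine (Finset.abs_sum_le_sum_abs _ _).trans ?_
      rw [← nsmul_eq_mul]
      exact Finset.sum_le_card_nsmul _ _ _ fun j hj => ha j (Finset.mem_insert_of_mem hj)
    have hk : (0 : ℝ) ≤ s.card := Nat.cast_nonneg _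
    have hε0 : 0 ≤ ε := (mul_nonneg hk ht).trans hst'
    have hchoose : (s.card.choose 2 : ℝ) = s.card * (s.card - 1) / 2 := Nat.cast_choose_two ℝ _
    have hchoose' : ((s.card + 1).choose 2 : ℝ) = s.card.choose 2 + s.card := by
      rw [Nat.cast_choose_two, hchoose]
      push_cast
      ring
    have hprod : |∏ j ∈ s, (1 + a j) - 1| ≤ (1 + ε) * (s.card * t) := by
      have htri : |∏ j ∈ s, (1 + a j) - 1| ≤
          (1 + ε) * (s.card.choose 2 : ℝ) * t ^ 2 + s.card * t := by
        have h := abs_add_le (∏ j ∈ s, (1 + a j) - 1 - ∑ j ∈ s, a j) (∑ j ∈ s, a j)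
        rw [sub_add_cancel] at h
        linarith
      have hc : (s.card.choose 2 : ℝ) * t ^ 2 ≤ (s.card * t) * ε / 2 := by
        have h1 : (s.card * t) * (s.card * t) ≤ (s.card * t) * ε :=
          mul_le_mul_of_nonneg_left hst' (mul_nonneg hk ht)
        have h2 : 0 ≤ s.card * t ^ 2 := by positivity
        rw [hchoose]
        linarith
      have h3 : (1 + ε) * ((s.card.choose 2 : ℝ) * t ^ 2) ≤ 2 * ((s.card * t) * ε / 2) :=
        mul_le_mul (by linarith) hc (by positivity) (by norm_num)
      linarith
    rw [Finset.prod_insert hi, Finset.sum_insert hi, hchoose']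
    have hsplit : (1 + a i) * ∏ j ∈ s, (1 + a j) - 1 - (a i + ∑ j ∈ s, a j) =
        (∏ j ∈ s, (1 + a j) - 1 - ∑ j ∈ s, a j) + a i * (∏ j ∈ s, (1 + a j) - 1) := by ring
    rw [hsplit]
    refine (abs_add_le _ _).trans ?_
    rw [abs_mul]
    have h4 : |a i| * |∏ j ∈ s, (1 + a j) - 1| ≤ t * ((1 + ε) * (s.card * t)) :=
      mul_le_mul hai hprod (abs_nonneg _) ht
    linarith

/-- A point of the simplex can be rounded to the grid of denominator `r` within its own face. -/
lemma exists_grid_point_near {n r : ℕ} (hr : r ≠ 0) {x : Fin n → ℝ}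
    (hx : x ∈ stdSimplex ℝ (Fin n)) :
    ∃ y ∈ stdSimplex ℝ (Fin n), (∀ i, ∃ l : ℕ, (r : ℝ) * y i = l) ∧
      ∀ i, |y i - x i| ≤ 1 / r ∧ (x i = 0 → y i = 0) := by
  have hr0 : (0 : ℝ) < r := by positivity
  have hrx : ∀ i, 0 ≤ (r : ℝ) * x i := fun i => mul_nonneg hr0.le (hx.1 i)
  set g : Fin n → ℕ := fun i => ⌊(r : ℝ) * x i⌋₊ with hg
  have hg1 : ∀ i, (g i : ℝ) ≤ r * x i := fun i => Nat.floor_le (hrx i)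
  have hg2 : ∀ i, (r : ℝ) * x i < g i + 1 := fun i => Nat.lt_floor_add_one _
  have hsum : ∑ i, (r : ℝ) * x i = r := by rw [← Finset.mul_sum, hx.2, mul_one]
  have hle : ∑ i, g i ≤ r := by
    have h : ((∑ i, g i : ℕ) : ℝ) ≤ r := by
      rw [← hsum]
      push_cast
      exact Finset.sum_le_sum fun i _ => hg1 i
    exact_mod_cast h
  set P : Finset (Fin n) := Finset.univ.filter fun i => x i ≠ 0 with hP
  have hcard : r - ∑ i, g i ≤ P.card := by
    have h : (r : ℝ) ≤ (∑ i, g i : ℕ) + P.card := by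
      rw [hP, Finset.natCast_card_filter]
      conv_lhs => rw [← hsum]
      push_cast
      rw [← Finset.sum_add_distrib]
      refine Finset.sum_le_sum fun i _ => ?_
      by_cases hi : x i = 0
      · simp [hi]
      · simpa [hi] using (hg2 i).le
    have h' : r ≤ ∑ i, g i + P.card := by exact_mod_cast h
    omega
  obtain ⟨T, hTP, hT⟩ := Finset.exists_subset_card_eq hcard
  set k : Fin n → ℕ := fun i => g i + if i ∈ T then 1 else 0 with hk
  have hksum : ∑ i, k i = r := by
    simp only [hk, Finset.sum_add_distrib, Finset.sum_boole, Finset.filter_mem_eq_inter,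
      Finset.univ_inter, hT, Nat.cast_id]
    omega
  refine ⟨fun i => k i / r, ⟨fun i => by positivity, ?_⟩, fun i => ⟨k i, by field_simp⟩,
    fun i => ⟨?_, fun hi => ?_⟩⟩
  · rw [← Finset.sum_div, ← Nat.cast_sum, hksum, div_self hr0.ne']
  · have h : (k i : ℝ) / r - x i = (k i - r * x i) / r := by field_simp
    rw [h, abs_div, abs_of_pos hr0]
    gcongr
    have h1 := hg1 i
    have h2 := hg2 i
    rw [abs_le]
    simp only [hk]
    split_ifs <;> push_cast <;> constructor <;> linarith
  · have hiT : i ∉ T := fun h => (Finset.mem_filter.mp (hTP h)).2 hi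
    simp [hk, hiT, hg, hi]

lemma tensorForm_mul_one_add {n d : ℕ} (B : (Fin d → Fin n) → ℝ) (x a : Fin n → ℝ) :
    tensorForm B (fun i => x i * (1 + a i)) =
      ∑ w, (B w * ∏ j, x (w j)) * ∏ j, (1 + a (w j)) := by
  simp only [tensorForm, Finset.prod_mul_distrib, mul_assoc]

/-- First-order optimality in the directions tangent to the face of the minimizer. -/
lemma firstOrder_eq_zero_of_isMin {n d : ℕ} (B : (Fin d → Fin n) → ℝ) {x a : Fin n → ℝ}
    (hx : x ∈ stdSimplex ℝ (Fin n))
    (hmin : ∀ y ∈ stdSimplex ℝ (Fin n), tensorForm B x ≤ tensorForm B y)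
    (ha : ∀ i, |a i| ≤ 1) (hxa : ∑ i, x i * a i = 0) :
    ∑ w, (B w * ∏ j, x (w j)) * ∑ j, a (w j) = 0 := by
  set φ : ℝ → ℝ := fun t => ∑ w, (B w * ∏ j, x (w j)) * ∏ j, (1 + t * a (w j)) with hφ
  have hφ0 : φ 0 = tensorForm B x := by simp [hφ, tensorForm]
  have hloc : IsLocalMin φ 0 := by
    filter_upwards [Ioo_mem_nhds (show (-1 : ℝ) < 0 by norm_num) one_pos] with t ht
    have hta : φ t = tensorForm B fun i => x i * (1 + t * a i) :=
      (tensorForm_mul_one_add B x fun i => t * a i).symm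
    rw [hφ0, hta]
    refine hmin _ ⟨fun i => mul_nonneg (hx.1 i) ?_, ?_⟩
    · have h : |t * a i| ≤ 1 := by
        rw [abs_mul]
        exact mul_le_one₀ (abs_lt.mpr ht).le (abs_nonneg _) (ha i)
      linarith [(abs_le.mp h).1]
    · have h : ∀ i, x i * (1 + t * a i) = x i + t * (x i * a i) := fun i => by ring
      simp only [h, Finset.sum_add_distrib, ← Finset.mul_sum, hxa, hx.2, mul_zero, add_zero]
  have hder : HasDerivAt φ (∑ w, (B w * ∏ j, x (w j)) * ∑ j, a (w j)) 0 := by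
    refine HasDerivAt.fun_sum fun w _ => HasDerivAt.const_mul _ ?_
    have h := HasDerivAt.fun_finsetProd (u := Finset.univ) (x := (0 : ℝ))
      (f := fun (j : Fin d) t => 1 + t * a (w j)) (f' := fun j => a (w j)) fun j _ => by
        simpa using ((hasDerivAt_id (0 : ℝ)).mul_const (a (w j))).const_add 1
    simpa using h
  exact hloc.hasDerivAt_eq_zero hder

theorem grid_search_smallest_component_bound (n d : ℕ) (hd : 1 ≤ d)
    (f : MvPolynomial (Fin n) ℝ) (hf : f.totalDegree = d)
    (xstar : Fin n → ℝ) (hxs : xstar ∈ stdSimplex ℝ (Fin n))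
    (hxsmin : ∀ y ∈ stdSimplex ℝ (Fin n), eval xstar f ≤ eval y f)
    (xmin : ℝ) (hxm1 : ∀ i, 0 < xstar i → xmin ≤ xstar i)
    (hxm2 : ∃ i, 0 < xstar i ∧ xstar i = xmin)
    (ε : ℝ) (hε0 : 0 < ε) (hε1 : ε ≤ 2 / 3)
    (r : ℕ) (hr : (d : ℝ) / (ε * xmin) ≤ (r : ℝ))
    (fmax fgrid : ℝ)
    (hmax : IsGreatest ((fun x => eval x f) '' stdSimplex ℝ (Fin n)) fmax)
    (hgrid : IsLeast ((fun x => eval x f) ''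
      {x | x ∈ stdSimplex ℝ (Fin n) ∧ ∀ i, ∃ l : ℕ, (r : ℝ) * x i = l}) fgrid) :
    fgrid - eval xstar f ≤
      (1 / (r : ℝ) ^ 2) * ((1 + ε) * (d : ℝ) ^ d * (d.choose 2 : ℝ) / xmin ^ 2) *
        ((2 * d - 1).choose d : ℝ) * (fmax - eval xstar f) := by
  have hxmin : 0 < xmin := by
    obtain ⟨i, hi, rfl⟩ := hxm2
    exact hi
  have hd0 : d ≠ 0 := by omega
  have hd1 : (1 : ℝ) ≤ d := by exact_mod_cast hd
  have hr0 : (0 : ℝ) < r := lt_of_lt_of_le (by positivity) hr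
  have hrne : r ≠ 0 := by exact_mod_cast hr0.ne'
  set M := fmax - eval xstar f with hMdef
  have hle : ∀ x ∈ stdSimplex ℝ (Fin n), eval x f ≤ fmax :=
    fun x hx => hmax.2 (Set.mem_image_of_mem _ hx)
  have hM0 : 0 ≤ M := sub_nonneg.mpr (hle _ hxs)
  obtain ⟨B₀, hB₀⟩ := exists_tensorForm_eval (d := d) (f - C (eval xstar f))
    ((totalDegree_sub_C_le f _).trans hf.le)
  have hB₀' : ∀ x ∈ stdSimplex ℝ (Fin n), tensorForm B₀ x = eval x f - eval xstar f := by
    intro x hx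
    rw [hB₀ x hx.2, map_sub, eval_C]
  set B := symmTensor B₀ with hBdef
  have hB : ∀ x ∈ stdSimplex ℝ (Fin n), tensorForm B x = eval x f - eval xstar f :=
    fun x hx => (tensorForm_symmTensor B₀ x).trans (hB₀' x hx)
  have hbound : ∀ w, |B w| ≤ (d : ℝ) ^ d * ((2 * d - 1).choose d : ℝ) * M := by
    refine abs_symmTensor_le hd0 B₀ hM0 fun x hx => ?_
    rw [hB₀' x hx, abs_of_nonneg (sub_nonneg.mpr (hxsmin x hx))]
    exact sub_le_sub_right (hle x hx) _
  obtain ⟨y, hy, hygrid, hynear⟩ := exists_grid_point_near hrne hxs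
  set a : Fin n → ℝ := fun i => (y i - xstar i) / xstar i with hadef
  set t : ℝ := 1 / (r * xmin) with htdef
  have ht : 0 ≤ t := by positivity
  have hdt : (d : ℝ) * t ≤ ε := by
    rw [div_le_iff₀ (by positivity)] at hr
    rw [htdef, mul_one_div, div_le_iff₀ (by positivity)]
    linarith
  have hat : ∀ i, |a i| ≤ t := by
    intro i
    rcases (hxs.1 i).eq_or_lt with h | h
    · simpa [hadef, ← h] using ht
    · rw [hadef, abs_div, abs_of_pos h, htdef, ← div_div]
      exact div_le_div₀ (by positivity) (hynear i).1 hxmin (hxm1 i h)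
  have hxa : ∀ i, xstar i * a i = y i - xstar i := by
    intro i
    by_cases h : xstar i = 0
    · simp [h, (hynear i).2 h]
    · rw [hadef, mul_div_cancel₀ _ h]
  have hya : y = fun i => xstar i * (1 + a i) := by
    ext i
    rw [mul_add, mul_one, hxa]
    ring
  have ha1 : ∀ i, |a i| ≤ 1 := fun i => (hat i).trans (by
    have : 1 * t ≤ d * t := mul_le_mul_of_nonneg_right hd1 ht
    linarith)
  have hfirst := firstOrder_eq_zero_of_isMin B hxs
    (fun z hz => by rw [hB _ hxs, hB z hz]; exact sub_le_sub_right (hxsmin z hz) _) ha1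
    (by simp only [hxa, Finset.sum_sub_distrib, hy.2, hxs.2, sub_self])
  have hzero : ∑ w, B w * ∏ j, xstar (w j) = 0 := by
    have := hB _ hxs
    rwa [sub_self] at this
  have hexp : eval y f - eval xstar f = ∑ w, (B w * ∏ j, xstar (w j)) *
      (∏ j, (1 + a (w j)) - 1 - ∑ j, a (w j)) := by
    rw [← hB y hy, hya, tensorForm_mul_one_add]
    simp only [mul_sub, Finset.sum_sub_distrib, mul_one, hfirst, hzero, sub_zero]
  have hweights : ∑ w : Fin d → Fin n, ∏ j, xstar (w j) = 1 := by
    rw [← Fintype.sum_pow, hxs.2, one_pow]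
  have hstep : eval y f - eval xstar f ≤ ∑ w : Fin d → Fin n, (∏ j, xstar (w j)) *
      (((d : ℝ) ^ d * ((2 * d - 1).choose d : ℝ) * M) *
        ((1 + ε) * (d.choose 2 : ℝ) * t ^ 2)) := by
    rw [hexp]
    refine Finset.sum_le_sum fun w _ => ?_
    have hp : 0 ≤ ∏ j, xstar (w j) := Finset.prod_nonneg fun j _ => hxs.1 _
    have hrem := abs_prod_one_add_sub_one_sub_sum_le Finset.univ (fun j => a (w j)) ht
      (fun j _ => hat (w j)) (ε := ε) (by simpa using hdt) hε1
    rw [Finset.card_univ, Fintype.card_fin] at hrem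
    rw [mul_comm (B w), mul_assoc]
    refine mul_le_mul_of_nonneg_left ((le_abs_self _).trans ?_) hp
    rw [abs_mul]
    exact mul_le_mul (hbound w) hrem (abs_nonneg _) (by positivity)
  rw [← Finset.sum_mul, hweights, one_mul] at hstep
  have hgy : fgrid ≤ eval y f := hgrid.2 ⟨y, ⟨hy, hygrid⟩, rfl⟩
  calc fgrid - eval xstar f ≤ eval y f - eval xstar f := sub_le_sub_right hgy _
    _ ≤ _ := hstep
    _ = _ := by
      rw [htdef]
      field_simp
end

section
/- Let f = ∑_{α∈ℕ^n_{=d}} f_α x^α be a homogeneous polynomial of degree d ≥ 1 in n variables all of whose coefficients are nonnegative, and let x* be a global minimizer of f over Δ_n with smallest positive component x*_min. Then for any 0 < ε ≤ 2/3 and any integer r ≥ d/(ε·x*_min), one has f_{min,Δ(n,r)} − f_{min,Δ_n} ≤ ((1+ε)·C(d,2)/(r²·(x*_min)²))·f_{min,Δ_n}. -/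
open MvPolynomial

/-- A quantitative first-order expansion of a product of factors close to `1`. -/
theorem Multiset.abs_prod_one_add_sub_le {ι : Type*} {δ : ι → ℝ} {τ : ℝ}
    (hδ : ∀ i, |δ i| ≤ τ) (hτ : 0 ≤ τ) (s : Multiset ι) (hs : (s.card : ℝ) * τ ≤ 2 / 3) :
    |(s.map fun i => 1 + δ i).prod - 1 - (s.map δ).sum| ≤
      (1 + s.card * τ) * (s.card.choose 2 : ℝ) * τ ^ 2 := by
  have hsum : ∀ s : Multiset ι, |(s.map δ).sum| ≤ s.card * τ := by
    intro s
    induction s using Multiset.induction_on with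
    | empty => simp
    | cons a s ih =>
      simp only [Multiset.map_cons, Multiset.sum_cons, Multiset.card_cons, Nat.cast_add,
        Nat.cast_one]
      linarith [abs_add_le (δ a) (s.map δ).sum, hδ a]
  induction s using Multiset.induction_on with
  | empty => simp
  | cons a s ih =>
    simp only [Multiset.map_cons, Multiset.sum_cons, Multiset.prod_cons, Multiset.card_cons] at hs ⊢
    have ih' := ih (by push_cast at hs; linarith)
    have hs' := hsum s
    set P := (s.map fun i => 1 + δ i).prod
    set L := (s.map δ).sum
    set k := s.card
    rw [Nat.cast_choose_two] at ih' ⊢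
    push_cast at hs ⊢
    have hk : (0 : ℝ) ≤ k := k.cast_nonneg
    have hchoose : (0 : ℝ) ≤ (k : ℝ) * (k - 1) := by
      rcases Nat.eq_zero_or_pos k with h | h
      · simp [h]
      · have : (1 : ℝ) ≤ k := by exact_mod_cast h
        nlinarith
    have h1 : |1 + δ a| ≤ 1 + τ := by
      have := abs_add_le 1 (δ a)
      rw [abs_one] at this
      linarith [hδ a]
    have hsplit : (1 + δ a) * P - 1 - (δ a + L) = (P - 1 - L) * (1 + δ a) + L * δ a := by ring
    have hA : |(P - 1 - L) * (1 + δ a)| ≤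
        ((1 + k * τ) * (k * (k - 1) / 2) * τ ^ 2) * (1 + τ) := by
      rw [abs_mul]
      exact mul_le_mul ih' h1 (abs_nonneg _) ((abs_nonneg _).trans ih')
    have hB : |L * δ a| ≤ k * τ * τ := by
      rw [abs_mul]
      exact mul_le_mul hs' (hδ a) (abs_nonneg _) (by positivity)
    rw [hsplit]
    refine (abs_add_le _ _).trans ((add_le_add hA hB).trans ?_)
    have hgap : (k : ℝ) * (k - 1) / 2 * τ ≤ k + 1 := by nlinarith
    have : 0 ≤ k * τ ^ 3 * (k + 1 - (k : ℝ) * (k - 1) / 2 * τ) :=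
      mul_nonneg (by positivity) (by linarith)
    nlinarith

/-- A homogeneous polynomial with nonnegative coefficients, at a multiplicative perturbation of a
nonnegative point, differs from its linearization by a quadratic relative error. -/
theorem MvPolynomial.IsHomogeneous.exists_abs_eval_mul_one_add_sub_le {n d : ℕ}
    {f : MvPolynomial (Fin n) ℝ} (hf : f.IsHomogeneous d) (hcoeff : ∀ α, 0 ≤ coeff α f)
    {x δ : Fin n → ℝ} (hx : ∀ i, 0 ≤ x i) {τ : ℝ} (hτ : 0 ≤ τ) (hδ : ∀ i, |δ i| ≤ τ)
    (hdτ : (d : ℝ) * τ ≤ 2 / 3) :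
    ∃ L : ℝ, ∀ t : ℝ, |t| ≤ 1 →
      |eval (fun i => x i * (1 + t * δ i)) f - eval x f - t * L| ≤
        t ^ 2 * ((1 + d * τ) * (d.choose 2 : ℝ) * τ ^ 2) * eval x f := by
  refine ⟨∑ α ∈ f.support, coeff α f * (∏ i, x i ^ α i) * ((Finsupp.toMultiset α).map δ).sum,
    fun t ht => ?_⟩
  rw [eval_eq', eval_eq', Finset.mul_sum, Finset.mul_sum, ← Finset.sum_sub_distrib,
    ← Finset.sum_sub_distrib]
  refine (Finset.abs_sum_le_sum_abs _ _).trans (Finset.sum_le_sum fun α hα => ?_)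
  have hcard : (Finsupp.toMultiset α).card = d := by
    rw [Finsupp.card_toMultiset, ← hf (mem_support_iff.mp hα), Finsupp.weight_apply]
    simp [Finsupp.sum]
  have htτ : |t| * τ ≤ τ := mul_le_of_le_one_left hτ ht
  have hexp := Multiset.abs_prod_one_add_sub_le (δ := fun i => t * δ i) (τ := |t| * τ)
    (fun i => by rw [abs_mul]; gcongr; exact hδ i) (by positivity) (Finsupp.toMultiset α)
    (by
      rw [hcard]
      exact (mul_le_mul_of_nonneg_left htτ d.cast_nonneg).trans hdτ)
  have hprod : ((Finsupp.toMultiset α).map fun i => 1 + t * δ i).prod =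
      ∏ i, (1 + t * δ i) ^ α i := by
    rw [Finset.prod_multiset_map_count, Finsupp.toFinset_toMultiset]
    simp only [Finsupp.count_toMultiset]
    exact Finset.prod_subset (Finset.subset_univ _) fun i _ hi => by
      rw [Finsupp.notMem_support_iff.mp hi, pow_zero]
  rw [hcard, hprod, Multiset.sum_map_mul_left] at hexp
  have hw : 0 ≤ coeff α f * ∏ i, x i ^ α i :=
    mul_nonneg (hcoeff α) (Finset.prod_nonneg fun i _ => pow_nonneg (hx i) _)
  have heq : coeff α f * ∏ i, (x i * (1 + t * δ i)) ^ α i - coeff α f * ∏ i, x i ^ α i -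
      t * (coeff α f * (∏ i, x i ^ α i) * ((Finsupp.toMultiset α).map δ).sum) =
      (coeff α f * ∏ i, x i ^ α i) *
        (∏ i, (1 + t * δ i) ^ α i - 1 - t * ((Finsupp.toMultiset α).map δ).sum) := by
    simp only [mul_pow, Finset.prod_mul_distrib]
    ring
  rw [heq, abs_mul, abs_of_nonneg hw, mul_comm]
  refine mul_le_mul_of_nonneg_right (hexp.trans ?_) hw
  rw [mul_pow, sq_abs]
  calc (1 + d * (|t| * τ)) * (d.choose 2 : ℝ) * (t ^ 2 * τ ^ 2)
      ≤ (1 + d * τ) * (d.choose 2 : ℝ) * (t ^ 2 * τ ^ 2) := by gcongr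
    _ = _ := by ring

/-- Rounding a nonnegative vector with integral sum to natural numbers, preserving the sum and
the zero entries, with error at most one in each entry. -/
theorem exists_nat_rounding {n : ℕ} (x : Fin n → ℝ) (hx : ∀ i, 0 ≤ x i) (r : ℕ)
    (hsum : ∑ i, x i = r) :
    ∃ l : Fin n → ℕ, ∑ i, l i = r ∧ (∀ i, x i = 0 → l i = 0) ∧ ∀ i, |(l i : ℝ) - x i| ≤ 1 := by
  let g : ℕ → ℝ := fun k => if h : k < n then x ⟨k, h⟩ else 0
  have hg : ∀ i : Fin n, g i = x i := fun i => by simp [g]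
  have hg0 : ∀ k, 0 ≤ g k := fun k => by
    simp only [g]
    split_ifs
    exacts [hx _, le_rfl]
  let S : ℕ → ℝ := fun k => ∑ j ∈ Finset.range k, g j
  have hS : ∀ k, S (k + 1) = S k + g k := fun k => Finset.sum_range_succ _ _
  have hS0 : ∀ k, 0 ≤ S k := fun k => Finset.sum_nonneg fun j _ => hg0 j
  have hmono : Monotone fun k => ⌊S k⌋₊ :=
    monotone_nat_of_le_succ fun k => Nat.floor_mono (by linarith [hS k, hg0 k])
  refine ⟨fun i => ⌊S (i + 1)⌋₊ - ⌊S i⌋₊, ?_, fun i hi => ?_, fun i => ?_⟩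
  · rw [Fin.sum_univ_eq_sum_range (fun k => ⌊S (k + 1)⌋₊ - ⌊S k⌋₊), Finset.sum_range_tsub hmono]
    have hSn : S n = r := by
      rw [← hsum]
      refine (Fin.sum_univ_eq_sum_range g n).symm.trans ?_
      exact Finset.sum_congr rfl fun i _ => hg i
    simp [hSn, S]
  · simp [hS, hg, hi]
  · have hle : ⌊S i⌋₊ ≤ ⌊S (i + 1)⌋₊ := hmono (Nat.le_succ _)
    rw [Nat.cast_sub hle, abs_le]
    have h1 := Nat.floor_le (hS0 i)
    have h2 := Nat.lt_floor_add_one (S i)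
    have h3 := Nat.floor_le (hS0 (i + 1))
    have h4 := Nat.lt_floor_add_one (S (i + 1))
    have h5 := hS i
    rw [hg] at h5
    constructor <;> linarith

theorem grid_search_nonneg_homogeneous_smallest_component (n d : ℕ) (hd : 1 ≤ d)
    (f : MvPolynomial (Fin n) ℝ) (hf : f.IsHomogeneous d)
    (hcoeff : ∀ α : Fin n →₀ ℕ, 0 ≤ coeff α f)
    (xstar : Fin n → ℝ) (hxs : xstar ∈ stdSimplex ℝ (Fin n))
    (hxsmin : ∀ y ∈ stdSimplex ℝ (Fin n), eval xstar f ≤ eval y f)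
    (xmin : ℝ) (hxm1 : ∀ i, 0 < xstar i → xmin ≤ xstar i)
    (hxm2 : ∃ i, 0 < xstar i ∧ xstar i = xmin)
    (ε : ℝ) (hε0 : 0 < ε) (hε1 : ε ≤ 2 / 3)
    (r : ℕ) (hr : (d : ℝ) / (ε * xmin) ≤ (r : ℝ))
    (fgrid : ℝ)
    (hgrid : IsLeast ((fun x => eval x f) ''
      {x | x ∈ stdSimplex ℝ (Fin n) ∧ ∀ i, ∃ l : ℕ, (r : ℝ) * x i = l}) fgrid) :
    fgrid - eval xstar f ≤
      ((1 + ε) * (d.choose 2 : ℝ) / ((r : ℝ) ^ 2 * xmin ^ 2)) * eval xstar f := by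
  obtain ⟨hx0, hx1⟩ := hxs
  have hxmin : 0 < xmin := by
    obtain ⟨i, hi, rfl⟩ := hxm2
    exact hi
  have hd' : (1 : ℝ) ≤ d := by exact_mod_cast hd
  have hr0 : (0 : ℝ) < r := lt_of_lt_of_le (by positivity) hr
  set τ : ℝ := 1 / (r * xmin) with hτdef
  have hτ0 : 0 ≤ τ := by positivity
  have hdτ : d * τ ≤ ε := by
    rw [div_le_iff₀ (by positivity)] at hr
    rw [hτdef, mul_one_div, div_le_iff₀ (by positivity)]
    linarith
  obtain ⟨l, hlsum, hl0, hl⟩ := exists_nat_rounding (fun i => r * xstar i)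
    (fun i => mul_nonneg hr0.le (hx0 i)) r (by rw [← Finset.mul_sum, hx1, mul_one])
  let δ : Fin n → ℝ := fun i => (l i / r - xstar i) / xstar i
  have hxδ : ∀ i, xstar i * δ i = l i / r - xstar i := by
    intro i
    rcases (hx0 i).eq_or_lt with h | h
    · simp [← h, hl0 i (by simp [← h])]
    · exact mul_div_cancel₀ _ h.ne'
  have hδ : ∀ i, |δ i| ≤ τ := by
    intro i
    rcases (hx0 i).eq_or_lt with h | h
    · simpa [δ, ← h] using hτ0
    · have hdiff : (l i : ℝ) / r - xstar i = (l i - r * xstar i) / r := by field_simp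
      simp only [δ, hdiff, div_div, abs_div]
      rw [abs_of_pos (mul_pos hr0 h), hτdef]
      gcongr
      exacts [hl i, hxm1 i h]
  have hsimplex : ∀ t : ℝ, |t| ≤ 1 →
      (fun i => xstar i * (1 + t * δ i)) ∈ stdSimplex ℝ (Fin n) := by
    intro t ht
    refine ⟨fun i => mul_nonneg (hx0 i) ?_, ?_⟩
    · have h1 : |t * δ i| ≤ 1 := by
        rw [abs_mul]
        exact mul_le_one₀ ht (abs_nonneg _) ((hδ i).trans (by nlinarith))
      linarith [neg_le_of_abs_le h1]
    · have : ∀ i, xstar i * (1 + t * δ i) = xstar i + t * (l i / r - xstar i) := fun i => by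
        rw [← hxδ]
        ring
      simp only [this, Finset.sum_add_distrib, ← Finset.mul_sum, Finset.sum_sub_distrib,
        ← Finset.sum_div, hx1, ← Nat.cast_sum, hlsum, div_self hr0.ne']
      ring
  obtain ⟨L, hL⟩ := hf.exists_abs_eval_mul_one_add_sub_le hcoeff hx0 hτ0 hδ (hdτ.trans hε1)
  have hF : 0 ≤ eval xstar f := by
    rw [eval_eq']
    exact Finset.sum_nonneg fun α _ =>
      mul_nonneg (hcoeff α) (Finset.prod_nonneg fun i _ => pow_nonneg (hx0 i) _)
  set K := (1 + d * τ) * (d.choose 2 : ℝ) * τ ^ 2 with hK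
  have hLK : ∀ s : ℝ, 0 < s → s ≤ 1 → L ≤ s * (K * eval xstar f) := by
    intro s hs hs1
    have hs' : |-s| ≤ 1 := by rwa [abs_neg, abs_of_pos hs]
    have h1 := (abs_le.mp (hL (-s) hs')).2
    have h2 := hxsmin _ (hsimplex (-s) hs')
    have h3 : s * L ≤ s * (s * (K * eval xstar f)) := by linarith
    exact le_of_mul_le_mul_left h3 hs
  have hL0 : L ≤ 0 := by
    have hKF : 0 ≤ K * eval xstar f := by positivity
    by_contra! hpos
    have h1 := hLK (L / (L + K * eval xstar f)) (by positivity)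
      ((div_le_one (by positivity)).mpr (by linarith))
    rw [div_mul_eq_mul_div, le_div_iff₀ (by positivity)] at h1
    nlinarith
  have hmem : eval (fun i => xstar i * (1 + 1 * δ i)) f ∈ (fun x => eval x f) ''
      {x | x ∈ stdSimplex ℝ (Fin n) ∧ ∀ i, ∃ l : ℕ, (r : ℝ) * x i = l} := by
    refine ⟨_, ⟨hsimplex 1 (by simp), fun i => ⟨l i, ?_⟩⟩, rfl⟩
    rw [one_mul, mul_add, hxδ]
    field_simp
    ring
  have hgrid_le := hgrid.2 hmem
  have hone := (abs_le.mp (hL 1 (by simp))).2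
  have hKle : K ≤ (1 + ε) * (d.choose 2 : ℝ) / ((r : ℝ) ^ 2 * xmin ^ 2) := by
    have : (1 + ε) * (d.choose 2 : ℝ) / ((r : ℝ) ^ 2 * xmin ^ 2) =
        (1 + ε) * (d.choose 2 : ℝ) * τ ^ 2 := by
      rw [hτdef]
      field_simp
    rw [this, hK]
    gcongr
  have := mul_le_mul_of_nonneg_right hKle hF
  linarith
end
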